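/- arXiv:1404.3805 — 3 statements merged into one kernel-verified Lean document; each statement's English description precedes it below -/
import Mathlib

section
/- Let S_1,…,S_n and S'_1,…,S'_n be two subchains (pairwise compatible D-admissible subsets of [±n] with weakly increasing cardinalities). If |S_i| = |S'_i| for all i = 1,…,n, and the number of indices i with |S_i| = n and S_i containing an even number of negative integers equals the number of indices i with |S'_i| = n and S'_i containing an even number of negative integers, then τ_{S_1}⋯τ_{S_n} = τ_{S'_1}⋯τ_{S'_n} in R^D_n. -/
open MvPolynomial

/-- The set `[±n]`, realized as `Fin n × Bool`: `(k, true) ↔ k+1` and `(k, false) ↔ −(k+1)`. -/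
abbrev PM (n : ℕ) := Fin n × Bool

/-- Negation on `[±n]`. -/
def negPM {n : ℕ} (p : PM n) : PM n := (p.1, !p.2)

/-- A subset `S ⊆ [±n]` is D-admissible if it is nonempty, contains no pair `{i, −i}`,
and `|S| ≠ n − 1`. -/
def DAdm (n : ℕ) (S : Finset (PM n)) : Prop :=
  S.Nonempty ∧ (∀ p ∈ S, negPM p ∉ S) ∧ S.card ≠ n - 1

instance (n : ℕ) (S : Finset (PM n)) : Decidable (DAdm n S) := by unfold DAdm; infer_instance

/-- Two D-admissible sets are compatible if `S ⊆ T`, or `T ⊆ S`, or `|S| = |T| = n` and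
`|S ∩ T| = n − 1`. -/
def Compat (n : ℕ) (S T : Finset (PM n)) : Prop :=
  S ⊆ T ∨ T ⊆ S ∨ (S.card = n ∧ T.card = n ∧ (S ∩ T).card = n - 1)

instance (n : ℕ) (S T : Finset (PM n)) : Decidable (Compat n S T) := by
  unfold Compat; infer_instance

/-- Index type of the variables: the D-admissible subsets of `[±n]`. -/
abbrev IdxD (n : ℕ) := {S : Finset (PM n) // DAdm n S}

/-- `ε_k(S) = 1` if `k ∈ S`, `−1` if `−k ∈ S`, and `0` otherwise. -/
def eps (n : ℕ) (k : Fin n) (S : Finset (PM n)) : ℤ :=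
  if (k, true) ∈ S then 1 else if (k, false) ∈ S then -1 else 0

/-- Generators of the defining ideal of `R^D_n`: (i) products `τ_S τ_T` for incompatible `S, T`;
(ii) for `k ≠ l` and each sign `e = ±1`,
`Σ_{|S|≤n−2} (ε_k(S) − e·ε_l(S)) τ_S + Σ_{|S|=n} ((ε_k(S) − e·ε_l(S))/2) τ_S`. -/
def relD (n : ℕ) : Set (MvPolynomial (IdxD n) ℤ) :=
  {p | ∃ S T : IdxD n, ¬ Compat n S.1 T.1 ∧ p = X S * X T} ∪
  {p | ∃ k l : Fin n, ∃ e : ℤ, (e = 1 ∨ e = -1) ∧ k ≠ l ∧ p =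
      (∑ S : IdxD n, if S.1.card ≤ n - 2 then C (eps n k S.1 - e * eps n l S.1) * X S else 0) +
      (∑ S : IdxD n, if S.1.card = n then C ((eps n k S.1 - e * eps n l S.1) / 2) * X S else 0)}

/-- The ring `R^D_n`. -/
abbrev RD (n : ℕ) := MvPolynomial (IdxD n) ℤ ⧸ Ideal.span (relD n)

/-- The class `τ_S ∈ R^D_n` of a D-admissible subset `S ⊆ [±n]`. -/
noncomputable def tauD (n : ℕ) (S : Finset (PM n)) : RD n :=
  if h : DAdm n S then Ideal.Quotient.mk _ (X (⟨S, h⟩ : IdxD n)) else 1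

/-- The subset `{1,…,i}` of `[±n]`. -/
def initSegD (n i : ℕ) : Finset (PM n) :=
  Finset.univ.filter (fun p : PM n => p.2 = true ∧ (p.1 : ℕ) < i)

/-- The subset `[n]_+ = {1,…,n−1,n}` of `[±n]`. -/
def fullPlus (n : ℕ) : Finset (PM n) :=
  Finset.univ.filter (fun p : PM n => p.2 = true)

/-- The subset `[n]_− = {1,…,n−1,−n}` of `[±n]`. -/
def fullMinus (n : ℕ) : Finset (PM n) :=
  Finset.univ.filter (fun p : PM n =>
    (p.2 = true ∧ (p.1 : ℕ) < n - 1) ∨ (p.2 = false ∧ (p.1 : ℕ) = n - 1))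

/-- The class of a point: `τ_{{1}} ⋯ τ_{{1,…,n−2}} · τ_{[n]_+} · τ_{[n]_−}`. -/
noncomputable def ptD (n : ℕ) : RD n :=
  (∏ i ∈ Finset.Icc 1 (n - 2), tauD n (initSegD n i)) * tauD n (fullPlus n) *
    tauD n (fullMinus n)

/-- The number of negative entries of `S ⊆ [±n]`. -/
def negCount {n : ℕ} (S : Finset (PM n)) : ℕ := (S.filter (fun p => p.2 = false)).card

namespace TypeD

variable {n : ℕ}

lemma negPM_negPM (p : PM n) : negPM (negPM p) = p := by simp [negPM]

/-- The hyperoctahedral group: permutations of `[±n]` commuting with negation. -/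
def signedPerm (n : ℕ) : Subgroup (Equiv.Perm (PM n)) where
  carrier := {w | ∀ p, w (negPM p) = negPM (w p)}
  mul_mem' {v w} hv hw p := by
    rw [Equiv.Perm.mul_apply, hw p, hv (w p), Equiv.Perm.mul_apply]
  one_mem' _ := rfl
  inv_mem' {w} hw p := by
    rw [Equiv.Perm.inv_eq_iff_eq, hw]
    simp

lemma signedPerm_neg (w : signedPerm n) (p : PM n) : w.1 (negPM p) = negPM (w.1 p) := w.2 p

lemma fst_eq_of_fst_apply_eq (w : signedPerm n) {p q : PM n} (h : (w.1 p).1 = (w.1 q).1) :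
    p.1 = q.1 := by
  have h2 : w.1 p = w.1 q ∨ w.1 p = negPM (w.1 q) := by
    generalize w.1 p = a at *
    generalize w.1 q = b at *
    obtain ⟨k, s⟩ := a
    obtain ⟨l, t⟩ := b
    obtain rfl : k = l := h
    cases s <;> cases t <;> simp [negPM]
  rw [← signedPerm_neg] at h2
  rcases h2 with h2 | h2
  · rw [w.1.injective h2]
  · rw [w.1.injective h2, negPM]

/-- The action of a signed permutation on subsets of `[±n]`. -/
def moveSet (w : signedPerm n) (S : Finset (PM n)) : Finset (PM n) := S.map w.1.toEmbedding

lemma mem_moveSet {w : signedPerm n} {S : Finset (PM n)} {p : PM n} :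
    w.1 p ∈ moveSet w S ↔ p ∈ S := by
  simp [moveSet]

lemma mem_moveSet_iff {w : signedPerm n} {S : Finset (PM n)} {p : PM n} :
    p ∈ moveSet w S ↔ w.1.symm p ∈ S := by
  simp [moveSet, Finset.mem_map_equiv]

lemma card_moveSet (w : signedPerm n) (S : Finset (PM n)) : (moveSet w S).card = S.card :=
  Finset.card_map _

lemma dAdm_moveSet (w : signedPerm n) {S : Finset (PM n)} (h : DAdm n S) :
    DAdm n (moveSet w S) := by
  refine ⟨by simpa [moveSet] using h.1, ?_, by rw [card_moveSet]; exact h.2.2⟩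
  intro p hp
  obtain ⟨q, rfl⟩ := w.1.surjective p
  rw [← signedPerm_neg, mem_moveSet]
  exact h.2.1 q (mem_moveSet.1 hp)

lemma compat_moveSet (w : signedPerm n) {S T : Finset (PM n)} :
    Compat n (moveSet w S) (moveSet w T) ↔ Compat n S T := by
  simp only [Compat, moveSet, Finset.map_subset_map, Finset.card_map, ← Finset.map_inter]

lemma moveSet_mul (v w : signedPerm n) (S : Finset (PM n)) :
    moveSet (v * w) S = moveSet v (moveSet w S) := by
  ext p
  simp only [mem_moveSet_iff]
  rfl

lemma moveSet_one (S : Finset (PM n)) : moveSet 1 S = S := by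
  ext p
  simp only [mem_moveSet_iff]
  rfl

instance : MulAction (signedPerm n) (IdxD n) where
  smul w S := ⟨moveSet w S.1, dAdm_moveSet w S.2⟩
  one_smul S := Subtype.ext (moveSet_one S.1)
  mul_smul v w S := Subtype.ext (moveSet_mul v w S.1)

lemma coe_smul (w : signedPerm n) (S : IdxD n) : (w • S).1 = moveSet w S.1 := rfl

/-- The generator of `R^D_n` attached to an admissible set. -/
noncomputable def tau (S : IdxD n) : RD n := Ideal.Quotient.mk _ (X S)

lemma tauD_eq (S : Finset (PM n)) (h : DAdm n S) : tauD n S = tau ⟨S, h⟩ := by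
  simp [tauD, tau, h]

/-- The coordinate of the indicator vector of `S` in the direction `p`. -/
def signCoord (p : PM n) (S : Finset (PM n)) : ℤ :=
  (if p ∈ S then 1 else 0) - (if negPM p ∈ S then 1 else 0)

lemma signCoord_neg (p : PM n) (S : Finset (PM n)) :
    signCoord (negPM p) S = - signCoord p S := by
  simp [signCoord, negPM_negPM]

lemma signCoord_move (w : signedPerm n) (p : PM n) (S : Finset (PM n)) :
    signCoord (w.1 p) (moveSet w S) = signCoord p S := by
  simp only [signCoord, ← signedPerm_neg, mem_moveSet]

lemma eps_eq_signCoord (k : Fin n) {S : Finset (PM n)} (h : DAdm n S) :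
    eps n k S = signCoord (k, true) S := by
  have := h.2.1 (k, true)
  simp only [negPM, Bool.not_true] at this
  simp only [eps, signCoord, negPM, Bool.not_true]
  split_ifs <;> simp_all

/-- The value of the root `p - q` on the ray generator attached to `S`. -/
def rootVal (n : ℕ) (p q : PM n) (S : Finset (PM n)) : ℤ :=
  if S.card ≤ n - 2 then signCoord p S - signCoord q S
  else if S.card = n then (signCoord p S - signCoord q S) / 2 else 0

lemma rootVal_move (w : signedPerm n) (p q : PM n) (S : Finset (PM n)) :
    rootVal n (w.1 p) (w.1 q) (moveSet w S) = rootVal n p q S := by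
  simp only [rootVal, card_moveSet, signCoord_move]

lemma tau_mul_tau {S T : IdxD n} (h : ¬ Compat n S.1 T.1) : tau S * tau T = 0 := by
  rw [tau, tau, ← map_mul, Ideal.Quotient.eq_zero_iff_mem]
  exact Ideal.subset_span (Or.inl ⟨S, T, h, rfl⟩)

lemma card_le_of_forall_neg {S : Finset (PM n)} (h : ∀ p ∈ S, negPM p ∉ S) : S.card ≤ n := by
  have : S.card ≤ (Finset.univ : Finset (Fin n)).card := by
    refine Finset.card_le_card_of_injOn Prod.fst (by simp) ?_
    rintro ⟨k, s⟩ hp ⟨l, t⟩ hq (rfl : k = l)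
    have := h _ hp
    cases s <;> cases t <;> simp_all [negPM]
  simpa using this

lemma mem_or_neg_mem {S : Finset (PM n)} (h : ∀ p ∈ S, negPM p ∉ S) (hc : S.card = n)
    (p : PM n) : p ∈ S ∨ negPM p ∈ S := by
  have himg : S.image Prod.fst = Finset.univ := by
    apply Finset.eq_univ_of_card
    rw [Finset.card_image_of_injOn, hc, Fintype.card_fin]
    rintro ⟨k, s⟩ hp ⟨l, t⟩ hq (rfl : k = l)
    have := h _ hp
    cases s <;> cases t <;> simp_all [negPM]
  have : p.1 ∈ S.image Prod.fst := himg ▸ Finset.mem_univ _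
  obtain ⟨⟨k, s⟩, hq, hk⟩ := Finset.mem_image.1 this
  obtain ⟨l, t⟩ := p
  obtain rfl : k = l := hk
  cases s <;> cases t <;> simp_all [negPM]

lemma signCoord_full {S : Finset (PM n)} (h : ∀ p ∈ S, negPM p ∉ S) (hc : S.card = n)
    (p : PM n) : signCoord p S = if p ∈ S then 1 else -1 := by
  have h1 := mem_or_neg_mem h hc p
  have h2 := h p
  simp only [signCoord]
  split_ifs <;> simp_all

lemma rootVal_swap (p q : PM n) {S : Finset (PM n)} (h : DAdm n S) :
    rootVal n q p S = - rootVal n p q S := by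
  unfold rootVal
  split_ifs with h1 h2
  · ring
  · rw [signCoord_full h.2.1 h2, signCoord_full h.2.1 h2]
    split_ifs <;> norm_num
  · rfl

lemma linearRel_eq (hn : 2 ≤ n) (k l : Fin n) {e : ℤ} (he : e = 1 ∨ e = -1) :
    (∑ S : IdxD n, if S.1.card ≤ n - 2 then C (eps n k S.1 - e * eps n l S.1) * X S else 0) +
      (∑ S : IdxD n, if S.1.card = n then C ((eps n k S.1 - e * eps n l S.1) / 2) * X S else 0) =
    ∑ S : IdxD n, (C (rootVal n (k, true) (l, decide (e = 1)) S.1) * X S :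
      MvPolynomial (IdxD n) ℤ) := by
  rw [← Finset.sum_add_distrib]
  refine Finset.sum_congr rfl fun S _ => ?_
  have hl : signCoord (l, decide (e = 1)) S.1 = e * eps n l S.1 := by
    rw [eps_eq_signCoord l S.2]
    rcases he with rfl | rfl
    · simp
    · have := signCoord_neg (l, true) S.1
      simpa [negPM] using this
  rw [eps_eq_signCoord k S.2, ← hl, rootVal]
  by_cases h1 : S.1.card ≤ n - 2
  · have h2 : S.1.card ≠ n := by omega
    rw [if_pos h1, if_pos h1, if_neg h2, add_zero]
  · by_cases h2 : S.1.card = n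
    · rw [if_neg h1, if_neg h1, if_pos h2, if_pos h2, zero_add]
    · rw [if_neg h1, if_neg h1, if_neg h2, if_neg h2]
      simp

lemma rootVal_neg_neg (p q : PM n) {S : Finset (PM n)} (h : DAdm n S) :
    rootVal n (negPM p) (negPM q) S = - rootVal n p q S := by
  rw [← rootVal_swap p q h]
  simp only [rootVal, signCoord_neg]
  ring_nf

/-- The linear relation of `R^D_n` given by the root `p - q`. -/
lemma sum_rootVal_tau (hn : 2 ≤ n) {p q : PM n} (hpq : p.1 ≠ q.1) :
    ∑ S : IdxD n, (rootVal n p q S.1 : RD n) * tau S = 0 := by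
  have hpos : ∀ (k l : Fin n) (t : Bool), k ≠ l →
      ∑ S : IdxD n, (rootVal n (k, true) (l, t) S.1 : RD n) * tau S = 0 := by
    intro k l t hkl
    have he : (if t then 1 else -1 : ℤ) = 1 ∨ (if t then 1 else -1 : ℤ) = -1 := by
      cases t <;> simp
    have h : Ideal.Quotient.mk (Ideal.span (relD n)) _ = 0 :=
      Ideal.Quotient.eq_zero_iff_mem.2 (Ideal.subset_span (Or.inr ⟨k, l, _, he, hkl, rfl⟩))
    rw [linearRel_eq hn k l he, map_sum] at h
    rw [← h]
    refine Finset.sum_congr rfl fun S _ => ?_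
    have hC : ∀ a : ℤ, Ideal.Quotient.mk (Ideal.span (relD n)) (C a) = (a : RD n) := fun a => by
      rw [eq_intCast (C : ℤ →+* MvPolynomial (IdxD n) ℤ) a, map_intCast]
    have ht : decide ((if t then 1 else -1 : ℤ) = 1) = t := by cases t <;> simp
    rw [map_mul, hC, ht, tau]
  obtain ⟨k, s⟩ := p
  obtain ⟨l, t⟩ := q
  cases s
  · rw [← neg_eq_zero, ← Finset.sum_neg_distrib, ← hpos k l (!t) hpq]
    refine Finset.sum_congr rfl fun S _ => ?_
    have h : rootVal n (k, true) (l, !t) S.1 = - rootVal n (k, false) (l, t) S.1 :=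
      rootVal_neg_neg (k, false) (l, t) S.2
    rw [h]
    push_cast
    ring
  · exact hpos k l t hpq

/-- The endomorphism of `R^D_n` induced by a signed permutation. -/
noncomputable def act (hn : 2 ≤ n) (w : signedPerm n) : RD n →+* RD n :=
  Ideal.Quotient.lift _ (eval₂Hom (Int.castRingHom (RD n)) fun S : IdxD n => tau (w • S)) <| by
    suffices Ideal.span (relD n) ≤ RingHom.ker
        (eval₂Hom (Int.castRingHom (RD n)) fun S : IdxD n => tau (w • S)) from
      fun a ha => this ha
    rw [Ideal.span_le]
    rintro _ (⟨S, T, h, rfl⟩ | ⟨k, l, e, he, hkl, rfl⟩)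
    · simp only [SetLike.mem_coe, RingHom.mem_ker, map_mul, coe_eval₂Hom, eval₂_X]
      exact tau_mul_tau fun hc => h ((compat_moveSet w).1 hc)
    · rw [SetLike.mem_coe, RingHom.mem_ker, linearRel_eq hn k l he]
      have hne : (w.1 (k, true)).1 ≠ (w.1 (l, decide (e = 1))).1 := fun h =>
        hkl (by simpa using fst_eq_of_fst_apply_eq w h)
      refine Eq.trans ?_ (sum_rootVal_tau hn hne)
      rw [map_sum]
      refine Eq.trans (Finset.sum_congr rfl fun S _ => ?_)
        (Equiv.sum_comp (MulAction.toPerm w) fun S : IdxD n => (rootVal n (w.1 (k, true))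
          (w.1 (l, decide (e = 1))) S.1 : RD n) * tau S)
      rw [MulAction.toPerm_apply, coe_smul, rootVal_move, map_mul, coe_eval₂Hom, eval₂_C,
        eval₂_X, eq_intCast]

lemma act_tau (hn : 2 ≤ n) (w : signedPerm n) (S : IdxD n) :
    act hn w (tau S) = tau (w • S) := by
  simp [act, tau]

/-- The signed permutation `(k, s) ↦ (σ k, s + t k)`. -/
def ofPermSign (σ : Equiv.Perm (Fin n)) (t : Fin n → Bool) : signedPerm n :=
  ⟨{ toFun := fun p => (σ p.1, p.2 ^^ t p.1)
     invFun := fun p => (σ.symm p.1, p.2 ^^ t (σ.symm p.1))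
     left_inv := fun p => by simp
     right_inv := fun p => by simp }, fun p => by simp [negPM]⟩

lemma ofPermSign_apply (σ : Equiv.Perm (Fin n)) (t : Fin n → Bool) (p : PM n) :
    (ofPermSign σ t).1 p = (σ p.1, p.2 ^^ t p.1) := rfl

lemma ofPermSign_symm_apply (σ : Equiv.Perm (Fin n)) (t : Fin n → Bool) (p : PM n) :
    (ofPermSign σ t).1.symm p = (σ.symm p.1, p.2 ^^ t (σ.symm p.1)) := rfl

lemma ofPermSign_mul (σ σ' : Equiv.Perm (Fin n)) (t t' : Fin n → Bool) :
    ofPermSign σ t * ofPermSign σ' t' = ofPermSign (σ * σ') fun k => t' k ^^ t (σ' k) := by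
  refine Subtype.ext (Equiv.ext fun p => ?_)
  simp [ofPermSign_apply]

lemma exists_eq_ofPermSign (w : signedPerm n) : ∃ σ t, w = ofPermSign σ t := by
  have hinj : Function.Injective fun k => (w.1 (k, true)).1 := fun k l h =>
    fst_eq_of_fst_apply_eq w h
  refine ⟨Equiv.ofBijective _ (Finite.injective_iff_bijective.1 hinj),
    fun k => !(w.1 (k, true)).2, Subtype.ext (Equiv.ext fun p => ?_)⟩
  obtain ⟨k, s⟩ := p
  rw [ofPermSign_apply]
  cases s
  · have := signedPerm_neg w (k, true)
    simp only [negPM, Bool.not_true] at this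
    simp [this]
  · simp

/-- The `a`-th member of the standard maximal flag: `{1, …, a + 1}`, except that for
`a + 1 = n - 1` it is `{1, …, n - 1, -n}`. -/
def stdSet (a : Fin n) : Finset (PM n) :=
  Finset.univ.filter fun p => (p.2 = true ∧ p.1 ≤ a) ∨ (p.2 = false ∧ a.1 + 2 = n ∧ p.1.1 + 1 = n)

lemma true_mem_stdSet {a k : Fin n} : (k, true) ∈ stdSet a ↔ k.1 ≤ a.1 := by
  simp [stdSet]

lemma false_mem_stdSet {a k : Fin n} : (k, false) ∈ stdSet a ↔ a.1 + 2 = n ∧ k.1 + 1 = n := by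
  simp [stdSet]

lemma card_graph (t : Fin n → Bool) :
    (Finset.univ.filter fun p : PM n => p.2 = t p.1).card = n := by
  have : (Finset.univ.filter fun p : PM n => p.2 = t p.1) =
      Finset.univ.image fun k => (k, t k) := by
    ext ⟨k, s⟩
    simp [eq_comm]
  rw [this, Finset.card_image_of_injective _ fun k l h => (Prod.ext_iff.1 h).1]
  simp

lemma card_stdSet_of_eq {a : Fin n} (h : a.1 + 2 = n) : (stdSet a).card = n := by
  refine Eq.trans (congrArg Finset.card ?_) (card_graph fun k => decide (k.1 ≤ a.1))
  ext ⟨k, s⟩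
  cases s
  · rw [false_mem_stdSet]
    simp
    omega
  · rw [true_mem_stdSet]
    simp

lemma card_stdSet_of_ne {a : Fin n} (h : a.1 + 2 ≠ n) : (stdSet a).card = a.1 + 1 := by
  have : stdSet a = (Finset.Iic a).image fun k => (k, true) := by
    ext ⟨k, s⟩
    cases s
    · rw [false_mem_stdSet]
      simp [h]
    · rw [true_mem_stdSet]
      simp
  rw [this, Finset.card_image_of_injective _ fun k l h => (Prod.ext_iff.1 h).1]
  simp

lemma dAdm_stdSet (a : Fin n) : DAdm n (stdSet a) := by
  refine ⟨⟨(a, true), true_mem_stdSet.2 le_rfl⟩, ?_, ?_⟩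
  · rintro ⟨k, s⟩ hp hq
    cases s <;> simp only [negPM, Bool.not_true, Bool.not_false, true_mem_stdSet,
      false_mem_stdSet] at hp hq <;> omega
  · by_cases h : a.1 + 2 = n
    · rw [card_stdSet_of_eq h]; omega
    · rw [card_stdSet_of_ne h]; omega

/-- The standard maximal flag as a family of indices of variables. -/
def std (a : Fin n) : IdxD n := ⟨stdSet a, dAdm_stdSet a⟩

lemma std_injective : Function.Injective (std (n := n)) := by
  intro a b h
  have h' : stdSet a = stdSet b := congrArg Subtype.val h
  have h1 : (a, true) ∈ stdSet b := h' ▸ true_mem_stdSet.2 le_rfl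
  have h2 : (b, true) ∈ stdSet a := h' ▸ true_mem_stdSet.2 le_rfl
  exact Fin.ext (le_antisymm (true_mem_stdSet.1 h1) (true_mem_stdSet.1 h2))

/-- The class of a point. -/
noncomputable def pt (n : ℕ) : RD n := ∏ a : Fin n, tau (std a)

lemma act_pt (hn : 2 ≤ n) (w : signedPerm n) : act hn w (pt n) = ∏ a, tau (w • std a) := by
  simp [pt, act_tau]

/-- The signed permutations fixing the class of a point. -/
noncomputable def stabPt (hn : 2 ≤ n) : Subgroup (signedPerm n) where
  carrier := {w | act hn w (pt n) = pt n}
  one_mem' := by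
    refine (act_pt hn 1).trans ?_
    simp [pt]
  mul_mem' {v w} hv hw := by
    have hv' : act hn v (pt n) = pt n := hv
    have hw' : act hn w (pt n) = pt n := hw
    refine (act_pt hn _).trans ?_
    simp only [mul_smul, ← act_tau hn v]
    rw [← map_prod, ← act_pt hn, hw', hv']
  inv_mem' {w} hw := by
    have hw' : act hn w (pt n) = pt n := hw
    have h : act hn w⁻¹ (act hn w (pt n)) = pt n := by
      rw [act_pt, map_prod]
      simp [act_tau, pt]
    rwa [hw'] at h

lemma mem_stabPt (hn : 2 ≤ n) {w : signedPerm n} :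
    w ∈ stabPt hn ↔ ∏ a, tau (w • std a) = pt n := by
  rw [← act_pt hn]
  rfl

lemma full_ext {S T : Finset (PM n)} (hS : ∀ p ∈ S, negPM p ∉ S) (hSc : S.card = n)
    (hT : ∀ p ∈ T, negPM p ∉ T) (hTc : T.card = n)
    (h : ∀ k, (k, true) ∈ S ↔ (k, true) ∈ T) : S = T := by
  ext ⟨k, s⟩
  cases s
  · have h1 := mem_or_neg_mem hS hSc (k, true)
    have h2 := mem_or_neg_mem hT hTc (k, true)
    have h3 := hS (k, true)
    have h4 := hT (k, true)
    have h5 := h k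
    simp only [negPM, Bool.not_true] at *
    tauto
  · exact h k

lemma mem_of_compat_full (hn : 2 ≤ n) {S T : Finset (PM n)} (h : Compat n S T) (hS : S.card = n)
    (hT : T.card = n) {x y : PM n} (hxT : x ∈ T) (hxS : x ∉ S) (hyT : y ∈ T) (hxy : y ≠ x) :
    y ∈ S := by
  rcases h with h | h | ⟨-, -, h⟩
  · rw [Finset.eq_of_subset_of_card_le h (by omega)] at hxS
    exact absurd hxT hxS
  · exact h hyT
  · by_contra hyS
    have hsub : S ∩ T ⊆ (T.erase x).erase y := by
      intro z hz
      rw [Finset.mem_inter] at hz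
      simp only [Finset.mem_erase]
      exact ⟨fun e => hyS (e ▸ hz.1), fun e => hxS (e ▸ hz.1), hz.2⟩
    have := Finset.card_le_card hsub
    rw [Finset.card_erase_of_mem (Finset.mem_erase.2 ⟨hxy, hyT⟩), Finset.card_erase_of_mem hxT]
      at this
    omega

lemma eq_or_le_of_dAdm {S : Finset (PM n)} (h : DAdm n S) : S.card = n ∨ S.card ≤ n - 2 := by
  have := card_le_of_forall_neg h.2.1
  have := h.2.2
  omega

lemma subset_of_compat {S T : Finset (PM n)} (h : Compat n S T) (hS : S.card < n)
    (hT : S.card ≤ T.card) : S ⊆ T := by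
  rcases h with h | h | ⟨h, -⟩
  · exact h
  · exact (Finset.eq_of_subset_of_card_le h hT).ge
  · omega

/-- The adjacent transposition exchanging `j` and `j + 1`. -/
def adjSwap (j : Fin n) (hj : j.1 + 1 < n) : signedPerm n :=
  ofPermSign (Equiv.swap j ⟨j.1 + 1, hj⟩) fun _ => false

lemma mem_moveSet_adjSwap {j : Fin n} {hj : j.1 + 1 < n} {S : Finset (PM n)} {k : Fin n}
    {s : Bool} : (k, s) ∈ moveSet (adjSwap j hj) S ↔ (Equiv.swap j ⟨j.1 + 1, hj⟩ k, s) ∈ S := by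
  rw [mem_moveSet_iff, adjSwap, ofPermSign_symm_apply]
  simp

lemma swap_val {j k : Fin n} {hj : j.1 + 1 < n} : (Equiv.swap j ⟨j.1 + 1, hj⟩ k).1 =
    if k.1 = j.1 then j.1 + 1 else if k.1 = j.1 + 1 then j.1 else k.1 := by
  rw [Equiv.swap_apply_def]
  simp only [Fin.ext_iff]
  split_ifs <;> rfl

lemma adjSwap_smul_std {j : Fin n} {hj : j.1 + 1 < n} {b : Fin n} (hb : b ≠ j) :
    adjSwap j hj • std b = std b := by
  apply Subtype.ext
  ext ⟨k, s⟩
  have hb' : b.1 ≠ j.1 := fun h => hb (Fin.ext h)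
  rw [coe_smul, mem_moveSet_adjSwap]
  cases s
  · simp only [std, false_mem_stdSet, swap_val]
    split_ifs <;> omega
  · simp only [std, true_mem_stdSet, swap_val]
    split_ifs <;> omega

lemma true_mem_of_compat_std {S : Finset (PM n)} {b : Fin n}
    (h : Compat n S (stdSet b)) (hb : b.1 + 2 < n) (hS : S.card = n) :
    ∀ k : Fin n, k ≤ b → (k, true) ∈ S := by
  intro k hk
  have hc := card_stdSet_of_ne (a := b) (by omega)
  have : Compat n (stdSet b) S := by
    rcases h with h | h | ⟨h1, h2, h3⟩
    · exact Or.inr (Or.inl h)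
    · exact Or.inl h
    · omega
  exact subset_of_compat this (by omega) (by omega) (true_mem_stdSet.2 hk)

/-- Only two rays form a cone with a given wall of the standard chamber and are not
orthogonal to the corresponding root. -/
lemma eq_std_or_of_rootVal_ne_zero (hn : 2 ≤ n) {j : Fin n} (hj : j.1 + 1 < n) {S : IdxD n}
    (hS : ∀ b ≠ j, Compat n S.1 (stdSet b))
    (h : rootVal n (j, true) (⟨j.1 + 1, hj⟩, true) S.1 ≠ 0) :
    S = std j ∨ S = adjSwap j hj • std j := by
  obtain ⟨S, hA⟩ := S
  simp only at hS h
  set j' : Fin n := ⟨j.1 + 1, hj⟩ with hj'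
  have hjv : j'.1 = j.1 + 1 := rfl
  have hneg := hA.2.1
  rcases eq_or_le_of_dAdm hA with hc | hc
  · have hxor : ¬ ((j, true) ∈ S ↔ (j', true) ∈ S) := by
      intro hiff
      apply h
      rw [rootVal, if_neg (by omega), if_pos hc, signCoord_full hneg hc, signCoord_full hneg hc]
      simp [hiff]
    by_cases hj2 : j.1 + 2 < n
    · exfalso
      obtain ⟨x, y, hx, hxS⟩ : ∃ x : Fin n, ∃ y : Fin n, (x.1 ≤ j.1 + 1) ∧ (x, true) ∉ S := by
        by_cases h1 : (j, true) ∈ S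
        · exact ⟨j', j, le_rfl, fun h2 => hxor (by tauto)⟩
        · exact ⟨j, j, by omega, h1⟩
      have hne1 : (⟨n - 1, by omega⟩ : Fin n) ≠ j := fun e => by
        have := congrArg Fin.val e
        simp at this
        omega
      have hne2 : (⟨n - 2, by omega⟩ : Fin n) ≠ j := fun e => by
        have := congrArg Fin.val e
        simp at this
        omega
      have h1 : ((⟨n - 1, by omega⟩ : Fin n), true) ∈ S := by
        refine mem_of_compat_full hn (hS _ hne1) hc ?_ (x := (x, true)) ?_ hxS ?_ ?_
        · rw [card_stdSet_of_ne] <;> simp <;> omega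
        · rw [true_mem_stdSet]; simp; omega
        · rw [true_mem_stdSet]
        · simp [Fin.ext_iff]; omega
      have h2 : ((⟨n - 1, by omega⟩ : Fin n), false) ∈ S := by
        refine mem_of_compat_full hn (hS _ hne2) hc ?_ (x := (x, true)) ?_ hxS ?_ ?_
        · rw [card_stdSet_of_eq]; simp; omega
        · rw [true_mem_stdSet]; simp; omega
        · rw [false_mem_stdSet]; simp; omega
        · simp
      exact hneg _ h1 h2
    · have hlow : ∀ k : Fin n, k.1 < j.1 → (k, true) ∈ S := fun k hk =>
        true_mem_of_compat_std (hS k (fun e => by simp [e] at hk)) (by omega) hc k le_rfl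
      have hcj := card_stdSet_of_eq (a := j) (by omega)
      have hsplit : ∀ k : Fin n, k.1 < j.1 ∨ k = j ∨ k = j' := fun k => by
        simp only [hj', Fin.ext_iff]
        omega
      by_cases h1 : (j, true) ∈ S
      · left
        refine Subtype.ext (full_ext hneg hc (dAdm_stdSet j).2.1 hcj fun k => ?_)
        change (k, true) ∈ S ↔ (k, true) ∈ stdSet j
        rw [true_mem_stdSet]
        rcases hsplit k with hk | rfl | rfl
        · simp [hlow k hk, hk.le]
        · simp [h1]
        · have : (j', true) ∉ S := fun h2 => hxor (by tauto)
          simp [this, hjv]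
      · right
        refine Subtype.ext (full_ext hneg hc (dAdm_moveSet _ (dAdm_stdSet j)).2.1
          ((card_moveSet _ _).trans hcj) fun k => ?_)
        change (k, true) ∈ S ↔ (k, true) ∈ moveSet (adjSwap j hj) (stdSet j)
        rw [mem_moveSet_adjSwap, true_mem_stdSet, swap_val]
        rcases hsplit k with hk | rfl | rfl
        · simp only [hlow k hk, true_iff]
          split_ifs <;> omega
        · simp [h1]
        · have : (j', true) ∈ S := by tauto
          simp [this, hjv]
  · have hlast : S ⊆ stdSet ⟨n - 1, by omega⟩ := by
      have hne1 : (⟨n - 1, by omega⟩ : Fin n) ≠ j := fun e => by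
        have := congrArg Fin.val e
        simp at this
        omega
      refine subset_of_compat (hS _ hne1) (by omega) ?_
      rw [card_stdSet_of_ne] <;> simp <;> omega
    have hfalse : ∀ k, (k, false) ∉ S := fun k hk => by
      have := (false_mem_stdSet.1 (hlast hk)).1
      simp at this
      omega
    have hxor : ¬ ((j, true) ∈ S ↔ (j', true) ∈ S) := by
      intro hiff
      apply h
      rw [rootVal, if_pos hc]
      simp [signCoord, negPM, hfalse, hiff]
    have hcmp : ∀ b, b ≠ j → (S ⊆ stdSet b ∨ (b.1 + 2 < n ∧ stdSet b ⊆ S)) := by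
      intro b hb
      by_cases hb2 : b.1 + 2 < n
      · rcases hS b hb with h | h | h
        · exact Or.inl h
        · exact Or.inr ⟨hb2, h⟩
        · omega
      · left
        refine subset_of_compat (hS b hb) (by omega) ?_
        by_cases hb3 : b.1 + 2 = n
        · rw [card_stdSet_of_eq hb3]; omega
        · rw [card_stdSet_of_ne hb3]; omega
    have hj2 : j.1 + 2 < n := by
      by_contra hj2
      have h3 : 3 ≤ n := by
        have := Finset.card_pos.2 hA.1
        omega
      have hne : (⟨n - 3, by omega⟩ : Fin n) ≠ j := fun e => by
        have := congrArg Fin.val e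
        simp at this
        omega
      have hcard := card_stdSet_of_ne (a := (⟨n - 3, by omega⟩ : Fin n)) (by simp; omega)
      have hsub : S ⊆ stdSet ⟨n - 3, by omega⟩ := by
        rcases hcmp _ hne with h | ⟨-, h⟩
        · exact h
        · exact (Finset.eq_of_subset_of_card_le h (by rw [hcard]; simp; omega)).ge
      apply hxor
      constructor <;> intro hm <;> have := true_mem_stdSet.1 (hsub hm) <;> simp [hj'] at this <;>
        omega
    have hlow : ∀ k : Fin n, k.1 < j.1 → (k, true) ∈ S := by
      intro k hk
      rcases hcmp k (fun e => by simp [e] at hk) with h | ⟨-, h⟩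
      · exfalso
        apply hxor
        constructor <;> intro hm <;> have := true_mem_stdSet.1 (h hm) <;> simp [hj'] at this <;>
          omega
      · exact h (true_mem_stdSet.2 le_rfl)
    have hup : ∀ k : Fin n, j.1 + 1 < k.1 → (k, true) ∉ S := by
      intro k hk hm
      rcases hcmp j' (fun e => by simp [hj', Fin.ext_iff] at e) with h | ⟨-, h⟩
      · have := true_mem_stdSet.1 (h hm)
        simp [hj'] at this
        omega
      · apply hxor
        have h1 : (j, true) ∈ S := h (true_mem_stdSet.2 (by simp [hj']))
        have h2 : (j', true) ∈ S := h (true_mem_stdSet.2 le_rfl)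
        tauto
    have hsplit : ∀ k : Fin n, k.1 < j.1 ∨ k = j ∨ k = j' ∨ j.1 + 1 < k.1 := fun k => by
      simp only [hj', Fin.ext_iff]
      omega
    by_cases h1 : (j, true) ∈ S
    · left
      have h2 : (j', true) ∉ S := fun h2 => hxor (by tauto)
      apply Subtype.ext
      ext ⟨k, s⟩
      cases s
      · simp only [hfalse, std, false_mem_stdSet, false_iff]
        omega
      · simp only [std, true_mem_stdSet]
        rcases hsplit k with hk | rfl | rfl | hk
        · simp [hlow k hk, hk.le]
        · simp [h1]
        · simp [h2, hjv]
        · simp only [hup k hk, false_iff]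
          omega
    · right
      have h2 : (j', true) ∈ S := by tauto
      apply Subtype.ext
      ext ⟨k, s⟩
      rw [coe_smul, mem_moveSet_adjSwap]
      cases s
      · simp only [hfalse, std, false_mem_stdSet, false_iff]
        omega
      · simp only [std, true_mem_stdSet, swap_val]
        rcases hsplit k with hk | rfl | rfl | hk
        · simp only [hlow k hk, true_iff]
          split_ifs <;> omega
        · simp [h1]
        · simp [h2, hjv]
        · simp only [hup k hk, false_iff]
          split_ifs <;> omega

/-- The simple roots, as differences of elements of `[±n]`. -/
def simpleRoot (hn : 2 ≤ n) (a : Fin n) : PM n × PM n :=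
  if h : a.1 + 1 < n then ((a, true), (⟨a.1 + 1, h⟩, true))
  else ((⟨n - 2, by omega⟩, true), (⟨n - 1, by omega⟩, false))

lemma simpleRoot_fst_ne (hn : 2 ≤ n) (a : Fin n) :
    (simpleRoot hn a).1.1 ≠ (simpleRoot hn a).2.1 := by
  unfold simpleRoot
  split_ifs with h <;> simp [Fin.ext_iff]
  omega

/-- The simple roots are dual to the rays of the standard chamber. -/
lemma rootVal_simpleRoot (hn : 2 ≤ n) (a b : Fin n) :
    rootVal n (simpleRoot hn a).1 (simpleRoot hn a).2 (stdSet b) = if a = b then 1 else 0 := by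
  have hcard : (stdSet b).card = n ∧ n ≤ b.1 + 2 ∨ (stdSet b).card ≤ n - 2 ∧ b.1 + 2 < n := by
    by_cases h : b.1 + 2 = n
    · rw [card_stdSet_of_eq h]; omega
    · rw [card_stdSet_of_ne h]; omega
  have hb := b.2
  have ha := a.2
  rw [rootVal]
  rcases hcard with ⟨h1, h2⟩ | ⟨h1, h2⟩
  · rw [if_neg (by omega), if_pos h1, signCoord_full (dAdm_stdSet b).2.1 h1,
      signCoord_full (dAdm_stdSet b).2.1 h1]
    by_cases h : a.1 + 1 < n
    · simp only [simpleRoot, dif_pos h, true_mem_stdSet, Fin.ext_iff]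
      split_ifs <;> omega
    · simp only [simpleRoot, dif_neg h, true_mem_stdSet, false_mem_stdSet, Fin.ext_iff]
      split_ifs <;> omega
  · rw [if_pos h1]
    by_cases h : a.1 + 1 < n
    · simp only [signCoord, simpleRoot, dif_pos h, true_mem_stdSet, Fin.ext_iff, negPM,
        false_mem_stdSet, Bool.not_true]
      split_ifs <;> omega
    · simp only [signCoord, simpleRoot, dif_neg h, true_mem_stdSet, Fin.ext_iff, negPM,
        false_mem_stdSet, Bool.not_true, Bool.not_false]
      split_ifs <;> omega

lemma adjSwap_mem_stabPt (hn : 2 ≤ n) {j : Fin n} (hj : j.1 + 1 < n) :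
    adjSwap j hj ∈ stabPt hn := by
  rw [mem_stabPt]
  set s := adjSwap j hj
  set m : RD n := ∏ b ∈ Finset.univ.erase j, tau (std b) with hm
  have hroot : simpleRoot hn j = ((j, true), (⟨j.1 + 1, hj⟩, true)) := by
    rw [simpleRoot, dif_pos hj]
  have h1 : rootVal n (j, true) (⟨j.1 + 1, hj⟩, true) (std j).1 = 1 := by
    have := rootVal_simpleRoot hn j j
    rwa [hroot, if_pos rfl] at this
  have h2 : rootVal n (j, true) (⟨j.1 + 1, hj⟩, true) (s • std j).1 = -1 := by
    have h3 : s.1 (⟨j.1 + 1, hj⟩, true) = (j, true) := by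
      simp [s, adjSwap, ofPermSign_apply]
    have h4 : s.1 (j, true) = (⟨j.1 + 1, hj⟩, true) := by
      simp [s, adjSwap, ofPermSign_apply]
    have := rootVal_move s (⟨j.1 + 1, hj⟩, true) (j, true) (std j).1
    rwa [h3, h4, rootVal_swap _ _ (std j).2, h1] at this
  have hne : std j ≠ s • std j := fun h => by
    rw [← h, h1] at h2
    omega
  have hsum : ∑ S : IdxD n, (rootVal n (j, true) (⟨j.1 + 1, hj⟩, true) S.1 : RD n) * tau S * m
      = 0 := by
    rw [← Finset.sum_mul, sum_rootVal_tau hn (by simp [Fin.ext_iff]), zero_mul]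
  rw [Finset.sum_eq_add (std j) (s • std j) hne] at hsum
  · rw [h1, h2] at hsum
    have hp : pt n = tau (std j) * m := (Finset.mul_prod_erase _ _ (Finset.mem_univ j)).symm
    have hq : ∏ a, tau (s • std a) = tau (s • std j) * m := by
      rw [← Finset.mul_prod_erase _ _ (Finset.mem_univ j), hm]
      congr 1
      refine Finset.prod_congr rfl fun b hb => ?_
      rw [adjSwap_smul_std (Finset.ne_of_mem_erase hb)]
    rw [hp, hq]
    push_cast at hsum
    linear_combination -hsum
  · rintro S - ⟨hS1, hS2⟩
    by_cases hz : rootVal n (j, true) (⟨j.1 + 1, hj⟩, true) S.1 = 0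
    · rw [hz]
      simp
    · have hex : ∃ b ≠ j, ¬ Compat n S.1 (stdSet b) := by
        by_contra! hall
        rcases eq_std_or_of_rootVal_ne_zero hn hj hall hz with h | h
        · exact hS1 h
        · exact hS2 h
      obtain ⟨b, hb, hc⟩ := hex
      rw [hm, ← Finset.mul_prod_erase _ _ (Finset.mem_erase.2 ⟨hb, Finset.mem_univ b⟩),
        mul_assoc, ← mul_assoc (tau S), tau_mul_tau hc]
      simp
  · simp
  · simp

/-- The group homomorphism sending a permutation to the corresponding signed permutation. -/
def permHom (n : ℕ) : Equiv.Perm (Fin n) →* signedPerm n where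
  toFun σ := ofPermSign σ fun _ => false
  map_one' := Subtype.ext (Equiv.ext fun p => by simp [ofPermSign_apply])
  map_mul' σ σ' := by rw [ofPermSign_mul]; simp

lemma permHom_mem_stabPt (hn : 2 ≤ n) (σ : Equiv.Perm (Fin n)) : permHom n σ ∈ stabPt hn := by
  obtain ⟨m, rfl⟩ : ∃ m, n = m + 1 := ⟨n - 1, by omega⟩
  have h : (⊤ : Submonoid (Equiv.Perm (Fin (m + 1)))) ≤
      ((stabPt hn).comap (permHom (m + 1))).toSubmonoid := by
    rw [← Equiv.Perm.mclosure_swap_castSucc_succ, Submonoid.closure_le]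
    rintro _ ⟨i, rfl⟩
    exact adjSwap_mem_stabPt hn (j := i.castSucc) (by simp)
  exact h (Submonoid.mem_top σ)

/-- The signed permutation changing the signs of the elements of `A`. -/
def flipSigns (A : Finset (Fin n)) : signedPerm n := ofPermSign 1 fun k => decide (k ∈ A)

lemma mem_flipSigns {A : Finset (Fin n)} {S : Finset (PM n)} {k : Fin n} {s : Bool} :
    (k, s) ∈ moveSet (flipSigns A) S ↔ (k, s ^^ decide (k ∈ A)) ∈ S := by
  rw [mem_moveSet_iff, flipSigns, ofPermSign_symm_apply]
  rfl

lemma flipSigns_smul_std (hn : 2 ≤ n) (b : Fin n) :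
    flipSigns {(⟨n - 1, by omega⟩ : Fin n)} • std b =
      std (Equiv.swap ⟨n - 2, by omega⟩ ⟨n - 1, by omega⟩ b) := by
  apply Subtype.ext
  have hb := b.2
  ext ⟨k, s⟩
  have hk := k.2
  have hv : (Equiv.swap (⟨n - 2, by omega⟩ : Fin n) ⟨n - 1, by omega⟩ b).1 =
      if b.1 = n - 2 then n - 1 else if b.1 = n - 1 then n - 2 else b.1 := by
    rw [Equiv.swap_apply_def]
    simp only [Fin.ext_iff]
    split_ifs <;> rfl
  rw [coe_smul, mem_flipSigns]
  by_cases hkl : k.1 = n - 1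
  · have : k ∈ ({⟨n - 1, by omega⟩} : Finset (Fin n)) := by simp [Fin.ext_iff, hkl]
    cases s <;> simp only [this, std, decide_true, Bool.false_xor, Bool.true_xor, Bool.not_true,
      true_mem_stdSet, false_mem_stdSet, hv] <;> split_ifs <;> omega
  · have : k ∉ ({⟨n - 1, by omega⟩} : Finset (Fin n)) := by simp [Fin.ext_iff, hkl]
    cases s <;> simp only [this, std, decide_false, Bool.xor_false,
      true_mem_stdSet, false_mem_stdSet, hv] <;> split_ifs <;> omega

lemma flipSigns_last_mem_stabPt (hn : 2 ≤ n) :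
    flipSigns {(⟨n - 1, by omega⟩ : Fin n)} ∈ stabPt hn := by
  rw [mem_stabPt]
  simp only [flipSigns_smul_std hn]
  rw [pt]
  exact Equiv.prod_comp (Equiv.swap (⟨n - 2, by omega⟩ : Fin n) ⟨n - 1, by omega⟩)
    fun b => tau (std b)

lemma flipSigns_mem_stabPt (hn : 2 ≤ n) (A : Finset (Fin n)) : flipSigns A ∈ stabPt hn := by
  induction A using Finset.induction_on with
  | empty =>
    have : flipSigns (∅ : Finset (Fin n)) = 1 :=
      Subtype.ext (Equiv.ext fun p => by simp [flipSigns, ofPermSign_apply])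
    rw [this]
    exact one_mem _
  | insert a A ha ih =>
    have h1 : flipSigns {a} ∈ stabPt hn := by
      have : flipSigns {a} = permHom n (Equiv.swap a ⟨n - 1, by omega⟩) *
          flipSigns {(⟨n - 1, by omega⟩ : Fin n)} * permHom n (Equiv.swap a ⟨n - 1, by omega⟩) := by
        refine Subtype.ext (Equiv.ext fun p => ?_)
        simp [flipSigns, permHom, ofPermSign_apply, Equiv.swap_apply_eq_iff]
      rw [this]
      exact mul_mem (mul_mem (permHom_mem_stabPt hn _) (flipSigns_last_mem_stabPt hn))
        (permHom_mem_stabPt hn _)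
    have h2 : flipSigns (insert a A) = flipSigns {a} * flipSigns A := by
      rw [flipSigns, flipSigns, flipSigns, ofPermSign_mul]
      congr 1
      funext k
      by_cases hk : k = a
      · subst hk
        simp [ha]
      · simp [hk]
    rw [h2]
    exact mul_mem h1 ih

/-- Every signed permutation fixes the class of a point. -/
lemma act_pt_eq (hn : 2 ≤ n) (w : signedPerm n) : act hn w (pt n) = pt n := by
  obtain ⟨σ, t, rfl⟩ := exists_eq_ofPermSign w
  have : ofPermSign σ t = permHom n σ * flipSigns (Finset.univ.filter fun k => t k = true) := by
    simp [permHom, flipSigns, ofPermSign_mul]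
  rw [this]
  exact mul_mem (permHom_mem_stabPt hn σ) (flipSigns_mem_stabPt hn _)

lemma exists_perm_of_chain {ι : Type*} (F : Finset ι) (D : ι → Finset (Fin n))
    (hD : ∀ i ∈ F, ∀ j ∈ F, D i ⊆ D j ∨ D j ⊆ D i) :
    ∃ σ : Equiv.Perm (Fin n), ∀ i ∈ F, ∀ k, σ k ∈ D i ↔ k.1 < (D i).card := by
  classical
  let f : Fin n → ℕ := fun k => (F.filter fun i => k ∉ D i).card
  refine ⟨Tuple.sort f, fun i hi => ?_⟩
  have hlower : ∀ k l, k ≤ l → Tuple.sort f l ∈ D i → Tuple.sort f k ∈ D i := by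
    intro k l hkl hl
    by_contra hk
    have h1 : f (Tuple.sort f k) ≤ f (Tuple.sort f l) := Tuple.monotone_sort f hkl
    refine absurd h1 (not_le.2 (Finset.card_lt_card (Finset.ssubset_iff_of_subset ?_ |>.2
      ⟨i, by simp [hi, hk], by simp [hl]⟩)))
    intro j hj
    simp only [Finset.mem_filter] at hj ⊢
    refine ⟨hj.1, fun hkj => ?_⟩
    rcases hD i hi j hj.1 with h | h
    · exact hj.2 (h hl)
    · exact hk (h hkj)
  set A : Finset (Fin n) := (D i).map (Tuple.sort f).symm.toEmbedding with hA
  have hmem : ∀ k, Tuple.sort f k ∈ D i ↔ k ∈ A := fun k => by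
    rw [hA, Finset.mem_map_equiv, Equiv.symm_symm]
  have hcard : A.card = (D i).card := Finset.card_map _
  intro k
  constructor
  · intro hk
    have : Finset.Iic k ⊆ A := fun l hl =>
      (hmem l).1 (hlower l k (Finset.mem_Iic.1 hl) hk)
    have := Finset.card_le_card this
    rw [Fin.card_Iic] at this
    omega
  · intro hk
    by_contra hn
    have : A ⊆ Finset.Iio k := fun l hl => by
      rw [Finset.mem_Iio]
      by_contra hlk
      exact hn (hlower k l (not_lt.1 hlk) ((hmem l).2 hl))
    have := Finset.card_le_card this
    rw [Fin.card_Iio] at this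
    omega

lemma negCount_insert {S : Finset (PM n)} {p : PM n} (hp : p ∉ S) :
    negCount (insert p S) = negCount S + if p.2 = false then 1 else 0 := by
  rw [negCount, negCount, Finset.filter_insert]
  split_ifs with h
  · rw [Finset.card_insert_of_notMem (by simp [hp])]
  · rfl

/-- Compatible sets of size `n` with the same parity of the number of negative entries agree. -/
lemma eq_of_compat_of_even_iff (hn : 2 ≤ n) {S T : Finset (PM n)} (hS : DAdm n S)
    (hSc : S.card = n) (hTc : T.card = n) (hT : DAdm n T) (h : Compat n S T)
    (hpar : Even (negCount S) ↔ Even (negCount T)) : S = T := by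
  rcases h with h | h | ⟨-, -, h⟩
  · exact Finset.eq_of_subset_of_card_le h (by omega)
  · exact (Finset.eq_of_subset_of_card_le h (by omega)).symm
  · exfalso
    have h1 := Finset.card_sdiff_add_card_inter S T
    obtain ⟨x, hx⟩ := Finset.card_eq_one.1 (show (S \ T).card = 1 by omega)
    have hxm : x ∈ S \ T := hx ▸ Finset.mem_singleton_self x
    rw [Finset.mem_sdiff] at hxm
    have hnx : negPM x ∈ T := (mem_or_neg_mem hT.2.1 hTc x).resolve_left hxm.2
    have hnxS : negPM x ∉ S := hS.2.1 x hxm.1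
    have hSi : insert x (S ∩ T) = S := by
      apply Finset.eq_of_subset_of_card_le
      · exact Finset.insert_subset hxm.1 Finset.inter_subset_left
      · rw [Finset.card_insert_of_notMem (by simp [hxm.2])]
        omega
    have hTi : insert (negPM x) (S ∩ T) = T := by
      apply Finset.eq_of_subset_of_card_le
      · exact Finset.insert_subset hnx Finset.inter_subset_right
      · rw [Finset.card_insert_of_notMem (by simp [hnxS])]
        omega
    have e1 := (congrArg negCount hSi).symm.trans (negCount_insert (by simp [hxm.2]))
    have e2 := (congrArg negCount hTi).symm.trans (negCount_insert (by simp [hnxS]))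
    rw [e1, e2] at hpar
    revert hpar
    cases hx2 : x.2 <;> by_cases hev : Even (negCount (S ∩ T)) <;>
      simp [negPM, hx2, Nat.even_add_one, hev]

/-- The elements `k` such that `S` contains `k` with the sign prescribed by `t`. -/
def agree (t : Fin n → Bool) (S : Finset (PM n)) : Finset (Fin n) :=
  Finset.univ.filter fun k => (k, t k) ∈ S

lemma mem_agree {t : Fin n → Bool} {S : Finset (PM n)} {k : Fin n} :
    k ∈ agree t S ↔ (k, t k) ∈ S := by
  simp [agree]

lemma card_agree (t : Fin n → Bool) (S : Finset (PM n)) :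
    (agree t S).card = (S ∩ Finset.univ.filter fun p : PM n => p.2 = t p.1).card := by
  rw [← Finset.card_image_of_injective (agree t S)
    (f := fun k => (k, t k)) fun k l h => (Prod.ext_iff.1 h).1]
  congr 1
  ext ⟨k, s⟩
  simp only [Finset.mem_image, mem_agree, Finset.mem_inter, Finset.mem_filter, Finset.mem_univ,
    true_and, Prod.mk.injEq]
  constructor
  · rintro ⟨l, hl, rfl, rfl⟩
    exact ⟨hl, rfl⟩
  · rintro ⟨h, rfl⟩
    exact ⟨k, h, rfl, rfl⟩

/-- A family of pairwise compatible admissible sets lies in a common system of signs, up to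
one coordinate. -/
lemma exists_signs (hn : 2 ≤ n) (F : Finset (IdxD n))
    (hF : ∀ S ∈ F, ∀ T ∈ F, Compat n S.1 T.1) :
    ∃ t : Fin n → Bool, (∀ S ∈ F, S.1.card ≤ n - 2 → ∀ p ∈ S.1, p.2 = t p.1) ∧
      ∀ S ∈ F, S.1.card = n → ∃ T ∈ F, T.1 = Finset.univ.filter fun p : PM n => p.2 = t p.1 := by
  rcases F.eq_empty_or_nonempty with rfl | hne
  · exact ⟨fun _ => true, by simp, by simp⟩
  · obtain ⟨U, hU, hmax⟩ := F.exists_max_image (fun S => S.1.card) hne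
    have hneg := U.2.2.1
    have hUt : ∀ p ∈ U.1, p.2 = decide ((p.1, true) ∈ U.1) := by
      rintro ⟨k, s⟩ hp
      have := hneg _ hp
      cases s <;> simp_all [negPM]
    refine ⟨fun k => decide ((k, true) ∈ U.1), ?_, ?_⟩
    · intro S hS hc p hp
      exact hUt p (subset_of_compat (hF S hS U hU) (by omega) (hmax S hS) hp)
    · intro S hS hc
      refine ⟨U, hU, Finset.eq_of_subset_of_card_le (fun p hp => by simpa using hUt p hp) ?_⟩
      exact (card_graph fun k => decide ((k, true) ∈ U.1)).trans_le (hc.symm.trans_le (hmax S hS))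

/-- Pairwise compatible admissible sets can be moved into the standard maximal flag. -/
lemma exists_smul_eq_std (hn : 2 ≤ n) (F : Finset (IdxD n))
    (hF : ∀ S ∈ F, ∀ T ∈ F, Compat n S.1 T.1) :
    ∃ w : signedPerm n, ∀ S ∈ F, ∃ a, w • S = std a := by
  obtain ⟨t, hsmall, hfull⟩ := exists_signs hn F hF
  have hcardfull : ∀ S ∈ F, S.1.card = n →
      (agree t S.1).card = n ∨ (agree t S.1).card = n - 1 := by
    intro S hS hc
    obtain ⟨U, hU, hUt⟩ := hfull S hS hc
    have hUc : U.1.card = n := by rw [hUt, card_graph]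
    rw [card_agree, ← hUt]
    rcases hF S hS U hU with h | h | ⟨-, -, h⟩
    · rw [Finset.inter_eq_left.2 h]; exact Or.inl hc
    · rw [Finset.inter_eq_right.2 h]; exact Or.inl hUc
    · exact Or.inr h
  have hcardsmall : ∀ S ∈ F, S.1.card ≤ n - 2 → (agree t S.1).card = S.1.card := by
    intro S hS hc
    rw [card_agree, Finset.inter_eq_left.2 fun p hp => by simpa using hsmall S hS hc p hp]
  have hmono : ∀ S T : IdxD n, S.1 ⊆ T.1 → agree t S.1 ⊆ agree t T.1 := fun S T h k hk =>
    mem_agree.2 (h (mem_agree.1 hk))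
  have hchain : ∀ S ∈ F, ∀ T ∈ F,
      agree t S.1 ⊆ agree t T.1 ∨ agree t T.1 ⊆ agree t S.1 := by
    intro S hS T hT
    rcases hF S hS T hT with h | h | ⟨h1, h2, -⟩
    · exact Or.inl (hmono _ _ h)
    · exact Or.inr (hmono _ _ h)
    · obtain ⟨U, hU, hUt⟩ := hfull S hS h1
      have hUc : U.1.card = n := by rw [hUt, card_graph]
      have hUa : agree t U.1 = Finset.univ := by
        ext k
        simp [mem_agree, hUt]
      by_cases hSU : S.1 = U.1
      · rw [hSU, hUa]; exact Or.inr (Finset.subset_univ _)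
      by_cases hTU : T.1 = U.1
      · rw [hTU, hUa]; exact Or.inl (Finset.subset_univ _)
      have hS' := mt (eq_of_compat_of_even_iff hn S.2 h1 hUc U.2 (hF S hS U hU)) hSU
      have hT' := mt (eq_of_compat_of_even_iff hn T.2 h2 hUc U.2 (hF T hT U hU)) hTU
      rw [eq_of_compat_of_even_iff hn S.2 h1 h2 T.2 (hF S hS T hT) (by tauto)]
      exact Or.inl subset_rfl
  obtain ⟨σ, hσ⟩ := exists_perm_of_chain F (fun S => agree t S.1) hchain
  refine ⟨(ofPermSign σ fun k => !t (σ k))⁻¹, fun S hS => ?_⟩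
  have hmem : ∀ k s, (k, s) ∈ moveSet (ofPermSign σ fun k => !t (σ k))⁻¹ S.1 ↔
      (σ k, s ^^ !t (σ k)) ∈ S.1 := fun k s => mem_moveSet_iff
  have htrue : ∀ k, (k, true) ∈ moveSet (ofPermSign σ fun k => !t (σ k))⁻¹ S.1 ↔
      k.1 < (agree t S.1).card := by
    intro k
    rw [hmem, ← hσ S hS, mem_agree]
    simp
  have hpos := Finset.card_pos.2 S.2.1
  rcases eq_or_le_of_dAdm S.2 with hc | hc
  · have hcf := hcardfull S hS hc
    refine ⟨⟨(agree t S.1).card - 1, by omega⟩, Subtype.ext ?_⟩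
    refine full_ext (dAdm_moveSet _ S.2).2.1 ((card_moveSet _ _).trans hc) (dAdm_stdSet _).2.1
      ?_ fun k => ?_
    · rcases hcf with h | h
      · change (stdSet _).card = n
        rw [card_stdSet_of_ne (by simp; omega)]
        simp
        omega
      · exact card_stdSet_of_eq (by simp; omega)
    · rw [coe_smul, htrue]
      refine Iff.trans ?_ true_mem_stdSet.symm
      simp only
      omega
  · have hcs := hcardsmall S hS hc
    refine ⟨⟨(agree t S.1).card - 1, by omega⟩, Subtype.ext ?_⟩
    ext ⟨k, s⟩
    rw [coe_smul, std]
    cases s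
    · rw [hmem, false_mem_stdSet]
      constructor
      · intro h
        have := hsmall S hS hc _ h
        simp at this
      · intro h
        simp only at h
        omega
    · rw [htrue, true_mem_stdSet]
      simp only
      omega

/-- The member of the standard maximal flag that an admissible set is moved to. -/
def stdOf (hn : 2 ≤ n) (S : IdxD n) : IdxD n :=
  if S.1.card = n then
    if Even (negCount S.1) then std ⟨n - 1, by omega⟩ else std ⟨n - 2, by omega⟩
  else std ⟨(S.1.card - 1) % n, Nat.mod_lt _ (by omega)⟩

lemma stdOf_of_card_ne (hn : 2 ≤ n) {S : IdxD n} {a : Fin n} (hS : S.1.card ≠ n)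
    {w : signedPerm n} (h : w • S = std a) : std a = stdOf hn S := by
  have hc : (stdSet a).card = S.1.card := by
    rw [← card_moveSet w S.1, ← coe_smul, h]
    rfl
  have ha : a.1 + 2 ≠ n := fun e => hS (by rw [← hc, card_stdSet_of_eq e])
  rw [card_stdSet_of_ne ha] at hc
  rw [stdOf, if_neg hS]
  congr 1
  ext
  simp [← hc, Nat.mod_eq_of_lt a.2]

lemma eq_or_eq_of_card_eq (hn : 2 ≤ n) {S : IdxD n} {a : Fin n} (hS : S.1.card = n)
    {w : signedPerm n} (h : w • S = std a) :
    a = ⟨n - 2, by omega⟩ ∨ a = ⟨n - 1, by omega⟩ := by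
  have hc : (stdSet a).card = S.1.card := by
    rw [← card_moveSet w S.1, ← coe_smul, h]
    rfl
  by_cases ha : a.1 + 2 = n
  · exact Or.inl (Fin.ext (by simp only; omega))
  · rw [card_stdSet_of_ne ha] at hc
    exact Or.inr (Fin.ext (by simp only; omega))

/-- Pairwise compatible admissible sets can be moved into the standard maximal flag in a way
that only depends on cardinalities and parities. -/
lemma exists_smul_eq_stdOf (hn : 2 ≤ n) (F : Finset (IdxD n))
    (hF : ∀ S ∈ F, ∀ T ∈ F, Compat n S.1 T.1) :
    ∃ w : signedPerm n, ∀ S ∈ F, w • S = stdOf hn S := by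
  obtain ⟨w, hw⟩ := exists_smul_eq_std hn F hF
  have hinj : ∀ S ∈ F, ∀ T ∈ F, S.1.card = n → T.1.card = n →
      (Even (negCount S.1) ↔ Even (negCount T.1)) → S = T := fun S hS T hT h1 h2 h =>
    Subtype.ext (eq_of_compat_of_even_iff hn S.2 h1 h2 T.2 (hF S hS T hT) h)
  have hne : ∀ S ∈ F, ∀ T ∈ F, ¬ (Even (negCount S.1) ↔ Even (negCount T.1)) →
      w • S ≠ w • T := by
    intro S hS T hT h e
    rw [MulAction.injective w e] at h
    exact h Iff.rfl
  by_cases hall : ∀ S ∈ F, w • S = stdOf hn S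
  · exact ⟨w, hall⟩
  · push Not at hall
    obtain ⟨S, hS, hbad⟩ := hall
    obtain ⟨a, ha⟩ := hw S hS
    have hSc : S.1.card = n := by
      by_contra h
      exact hbad (ha.trans (stdOf_of_card_ne hn h ha))
    refine ⟨flipSigns {(⟨n - 1, by omega⟩ : Fin n)} * w, fun T hT => ?_⟩
    obtain ⟨b, hb⟩ := hw T hT
    have hsmul : (flipSigns {(⟨n - 1, by omega⟩ : Fin n)} * w) • T =
        std (Equiv.swap ⟨n - 2, by omega⟩ ⟨n - 1, by omega⟩ b) := by
      rw [mul_smul, hb, flipSigns_smul_std hn]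
    by_cases hTc : T.1.card = n
    · rw [hsmul]
      have h1 := eq_or_eq_of_card_eq hn hSc ha
      have h2 := eq_or_eq_of_card_eq hn hTc hb
      rw [stdOf, if_pos hTc]
      rw [ha, stdOf, if_pos hSc] at hbad
      have hab : ¬ (Even (negCount S.1) ↔ Even (negCount T.1)) → a ≠ b := by
        intro h e
        exact hne S hS T hT h (by rw [ha, hb, e])
      have hab' : (Even (negCount S.1) ↔ Even (negCount T.1)) → a = b := by
        intro h
        have e := hinj S hS T hT hSc hTc h
        rw [← e, ha] at hb
        exact std_injective hb
      clear hne hinj hsmul hb ha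
      have huv : (⟨n - 2, by omega⟩ : Fin n) ≠ ⟨n - 1, by omega⟩ := by
        simp only [ne_eq, Fin.mk.injEq]
        omega
      generalize (⟨n - 2, by omega⟩ : Fin n) = u at *
      generalize (⟨n - 1, by omega⟩ : Fin n) = v at *
      rcases h1 with rfl | rfl <;> rcases h2 with rfl | rfl <;>
        by_cases p : Even (negCount S.1) <;> by_cases q : Even (negCount T.1) <;>
        simp [p, q, huv, huv.symm] at hbad hab hab' ⊢
    · rw [hsmul, ← stdOf_of_card_ne hn hTc hb]
      congr 1
      have hc : (stdSet b).card = T.1.card := by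
        rw [← card_moveSet w T.1, ← coe_smul, hb]
        rfl
      have hb2 : b.1 + 2 ≠ n := fun e => hTc (by rw [← hc, card_stdSet_of_eq e])
      rw [card_stdSet_of_ne hb2] at hc
      refine Equiv.swap_apply_of_ne_of_ne (fun e => ?_) fun e => ?_
      · have := congrArg Fin.val e
        simp only at this
        omega
      · have := congrArg Fin.val e
        simp only at this
        omega

/-- A square-free product of `n` pairwise compatible variables is the class of a point. -/
lemma prod_tau_eq_pt (hn : 2 ≤ n) (F : Finset (IdxD n)) (hFc : F.card = n)
    (hF : ∀ S ∈ F, ∀ T ∈ F, Compat n S.1 T.1) : ∏ S ∈ F, tau S = pt n := by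
  classical
  obtain ⟨w, hw⟩ := exists_smul_eq_std hn F hF
  have himg : F.image (w • ·) = Finset.univ.image std := by
    apply Finset.eq_of_subset_of_card_le
    · intro T hT
      obtain ⟨S, hS, rfl⟩ := Finset.mem_image.1 hT
      obtain ⟨a, ha⟩ := hw S hS
      exact Finset.mem_image.2 ⟨a, Finset.mem_univ a, ha.symm⟩
    · rw [Finset.card_image_of_injective _ (MulAction.injective w), hFc]
      exact Finset.card_image_le.trans (by simp)
  have h1 : act hn w (∏ S ∈ F, tau S) = pt n := by
    rw [map_prod, pt]
    simp only [act_tau]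
    rw [← Finset.prod_image (g := (w • ·)) (f := tau) (fun x _ y _ h => MulAction.injective w h),
      himg, Finset.prod_image fun x _ y _ h => std_injective h]
  have h2 : act hn w⁻¹ (act hn w (∏ S ∈ F, tau S)) = ∏ S ∈ F, tau S := by
    simp [map_prod, act_tau]
  rw [← h2, h1, act_pt_eq]

/-- A variable is congruent to a combination of other variables, none of which occurs in a given
compatible family. -/
lemma exists_tau_eq_sum (hn : 2 ≤ n) (F : Finset (IdxD n))
    (hF : ∀ S ∈ F, ∀ T ∈ F, Compat n S.1 T.1) {S : IdxD n} (hS : S ∈ F) :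
    ∃ c : IdxD n → ℤ, (∀ T ∈ F, c T = 0) ∧ tau S = ∑ T, (c T : RD n) * tau T := by
  classical
  obtain ⟨w, hw⟩ := exists_smul_eq_std hn F hF
  obtain ⟨a, ha⟩ := hw S hS
  set p := w.1.symm (simpleRoot hn a).1 with hp
  set q := w.1.symm (simpleRoot hn a).2 with hq
  have hpq : p.1 ≠ q.1 := fun h => simpleRoot_fst_ne hn a (by
    simpa [hp, hq] using fst_eq_of_fst_apply_eq w⁻¹ h)
  have hval : ∀ T ∈ F, rootVal n p q T.1 = if T = S then 1 else 0 := by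
    intro T hT
    obtain ⟨b, hb⟩ := hw T hT
    have h1 := rootVal_move w p q T.1
    rw [← coe_smul, hb, hp, hq, Equiv.apply_symm_apply, Equiv.apply_symm_apply] at h1
    rw [hp, hq, ← h1]
    refine (rootVal_simpleRoot hn a b).trans ?_
    have : a = b ↔ T = S := by
      rw [← (MulAction.injective w).eq_iff (a := T), ha, hb, std_injective.eq_iff, eq_comm]
    simp [this]
  refine ⟨fun T => (if T = S then 1 else 0) - rootVal n p q T.1, fun T hT => ?_, ?_⟩
  · simp [hval T hT]
  · have h0 := sum_rootVal_tau hn hpq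
    simp [sub_mul, Finset.sum_sub_distrib, h0]

lemma prod_tau_eq_zero {m : Multiset (IdxD n)}
    (h : ¬ ∀ S ∈ m, ∀ T ∈ m, Compat n S.1 T.1) : (m.map tau).prod = 0 := by
  push Not at h
  obtain ⟨S, hS, T, hT, hST⟩ := h
  have hne : T ≠ S := by
    rintro rfl
    exact hST (Or.inl subset_rfl)
  obtain ⟨m, rfl⟩ := Multiset.exists_cons_of_mem hS
  obtain ⟨m, rfl⟩ := Multiset.exists_cons_of_mem ((Multiset.mem_cons.1 hT).resolve_left hne)
  rw [Multiset.map_cons, Multiset.map_cons, Multiset.prod_cons, Multiset.prod_cons, ← mul_assoc,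
    tau_mul_tau hST, zero_mul]

lemma prod_tau_mem_zmultiples_of_nodup (hn : 2 ≤ n) {m : Multiset (IdxD n)}
    (hm : Multiset.card m = n) (hnd : m.Nodup) :
    (m.map tau).prod ∈ AddSubgroup.zmultiples (pt n) := by
  by_cases hF : ∀ S ∈ m, ∀ T ∈ m, Compat n S.1 T.1
  · have : (m.map tau).prod = pt n := prod_tau_eq_pt hn ⟨m, hnd⟩ hm hF
    rw [this]
    exact AddSubgroup.mem_zmultiples _
  · rw [prod_tau_eq_zero hF]
    exact zero_mem _

/-- The top degree part of `R^D_n` is generated by the class of a point. -/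
lemma prod_tau_mem_zmultiples (hn : 2 ≤ n) (d : ℕ) : ∀ m : Multiset (IdxD n),
    Multiset.card m = n → n ≤ m.toFinset.card + d →
      (m.map tau).prod ∈ AddSubgroup.zmultiples (pt n) := by
  classical
  induction d with
  | zero =>
    intro m hm hd
    have hnd : m.Nodup := Multiset.toFinset_card_eq_card_iff_nodup.1
      (le_antisymm (Multiset.toFinset_card_le m) (by omega))
    exact prod_tau_mem_zmultiples_of_nodup hn hm hnd
  | succ d ih =>
    intro m hm hd
    by_cases hnd : m.Nodup
    · exact prod_tau_mem_zmultiples_of_nodup hn hm hnd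
    by_cases hF : ∀ S ∈ m, ∀ T ∈ m, Compat n S.1 T.1
    · obtain ⟨S, hS⟩ : ∃ S, S ::ₘ S ::ₘ 0 ≤ m := by
        simpa [Multiset.nodup_iff_le] using hnd
      obtain ⟨m', rfl⟩ := Multiset.le_iff_exists_add.1 hS
      simp only [Multiset.cons_add, zero_add] at hm hd hF ⊢
      obtain ⟨c, hc, hsum⟩ := exists_tau_eq_sum hn (S ::ₘ S ::ₘ m').toFinset
        (by simpa only [Multiset.mem_toFinset] using hF) (S := S) (by simp)
      rw [Multiset.map_cons, Multiset.prod_cons]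
      nth_rewrite 1 [hsum]
      rw [Finset.sum_mul]
      refine sum_mem fun T _ => ?_
      by_cases hT : T ∈ S ::ₘ S ::ₘ m'
      · rw [hc T (Multiset.mem_toFinset.2 hT)]
        simp
      · rw [mul_assoc, ← zsmul_eq_mul, ← Multiset.prod_cons, ← Multiset.map_cons]
        refine AddSubgroup.zsmul_mem _ (ih _ (by simpa using hm) ?_) _
        have h1 : (S ::ₘ S ::ₘ m').toFinset = (S ::ₘ m').toFinset := by simp
        have h2 : T ∉ (S ::ₘ m').toFinset := by
          rw [← h1, Multiset.mem_toFinset]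
          exact hT
        rw [Multiset.toFinset_cons, Finset.card_insert_of_notMem h2, ← h1]
        omega
    · rw [prod_tau_eq_zero hF]
      exact zero_mem _

/-- The product of `n` pairwise compatible variables depends only on cardinalities and parities. -/
lemma prod_tau_eq_prod_stdOf (hn : 2 ≤ n) (A : ℕ → IdxD n)
    (hA : ∀ i ∈ Finset.Icc 1 n, ∀ j ∈ Finset.Icc 1 n, Compat n (A i).1 (A j).1) :
    ∏ i ∈ Finset.Icc 1 n, tau (A i) = ∏ i ∈ Finset.Icc 1 n, tau (stdOf hn (A i)) := by
  classical
  obtain ⟨w, hw⟩ := exists_smul_eq_stdOf hn ((Finset.Icc 1 n).image A) (by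
    simpa only [Finset.forall_mem_image] using hA)
  have hmem := prod_tau_mem_zmultiples hn n ((Finset.Icc 1 n).val.map A) (by simp) (by omega)
  obtain ⟨c, hc⟩ := AddSubgroup.mem_zmultiples_iff.1 hmem
  have hprod : ∏ i ∈ Finset.Icc 1 n, tau (A i) = c • pt n := by
    rw [hc, Multiset.map_map]
    rfl
  calc ∏ i ∈ Finset.Icc 1 n, tau (A i) = act hn w (∏ i ∈ Finset.Icc 1 n, tau (A i)) := by
        rw [hprod, map_zsmul, act_pt_eq]
    _ = ∏ i ∈ Finset.Icc 1 n, tau (stdOf hn (A i)) := by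
        rw [map_prod]
        exact Finset.prod_congr rfl fun i hi => by
          rw [act_tau, hw _ (Finset.mem_image_of_mem A hi)]

lemma prod_stdOf_eq (hn : 2 ≤ n) (A A' : ℕ → IdxD n)
    (hcard : ∀ i ∈ Finset.Icc 1 n, (A i).1.card = (A' i).1.card)
    (heven : ((Finset.Icc 1 n).filter
        fun i => (A i).1.card = n ∧ Even (negCount (A i).1)).card =
      ((Finset.Icc 1 n).filter fun i => (A' i).1.card = n ∧ Even (negCount (A' i).1)).card) :
    ∏ i ∈ Finset.Icc 1 n, tau (stdOf hn (A i)) = ∏ i ∈ Finset.Icc 1 n, tau (stdOf hn (A' i)) := by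
  classical
  have hsplit : ∀ B : ℕ → IdxD n, ∏ i ∈ Finset.Icc 1 n, tau (stdOf hn (B i)) =
      tau (std ⟨n - 1, by omega⟩) ^
        ((Finset.Icc 1 n).filter fun i => (B i).1.card = n ∧ Even (negCount (B i).1)).card *
      tau (std ⟨n - 2, by omega⟩) ^
        (((Finset.Icc 1 n).filter fun i => (B i).1.card = n).card -
        ((Finset.Icc 1 n).filter fun i => (B i).1.card = n ∧ Even (negCount (B i).1)).card) *
      ∏ i ∈ (Finset.Icc 1 n).filter (fun i => (B i).1.card ≠ n),
        tau (std ⟨((B i).1.card - 1) % n, Nat.mod_lt _ (by omega)⟩) := by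
    intro B
    rw [← Finset.prod_filter_mul_prod_filter_not (Finset.Icc 1 n) fun i => (B i).1.card = n,
      ← Finset.prod_filter_mul_prod_filter_not ((Finset.Icc 1 n).filter fun i => (B i).1.card = n)
        fun i => Even (negCount (B i).1)]
    have hk := Finset.card_filter_add_card_filter_not
      (s := (Finset.Icc 1 n).filter fun i => (B i).1.card = n) fun i => Even (negCount (B i).1)
    rw [Finset.filter_filter] at hk
    rw [← Finset.filter_filter, Finset.filter_filter]
    congr 1
    · congr 1
      · rw [Finset.prod_congr rfl (g := fun _ => tau (std ⟨n - 1, by omega⟩)), Finset.prod_const]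
        intro i hi
        rw [Finset.mem_filter] at hi
        rw [stdOf, if_pos hi.2.1, if_pos hi.2.2]
      · rw [Finset.prod_congr rfl (g := fun _ => tau (std ⟨n - 2, by omega⟩)), Finset.prod_const]
        · congr 1
          omega
        · intro i hi
          rw [Finset.mem_filter, Finset.mem_filter] at hi
          rw [stdOf, if_pos hi.1.2, if_neg hi.2]
    · refine Finset.prod_congr rfl fun i hi => ?_
      rw [stdOf, if_neg (Finset.mem_filter.1 hi).2]
  have h1 : (Finset.Icc 1 n).filter (fun i => (A i).1.card = n) =
      (Finset.Icc 1 n).filter fun i => (A' i).1.card = n :=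
    Finset.filter_congr fun i hi => by rw [hcard i hi]
  have h2 : (Finset.Icc 1 n).filter (fun i => (A i).1.card ≠ n) =
      (Finset.Icc 1 n).filter fun i => (A' i).1.card ≠ n :=
    Finset.filter_congr fun i hi => by rw [hcard i hi]
  rw [hsplit A, hsplit A', heven, h1, h2]
  congr 1
  refine Finset.prod_congr rfl fun i hi => ?_
  simp only [hcard i (Finset.mem_filter.1 hi).1]

end TypeD

/-- Let `S_1,…,S_n` and `S'_1,…,S'_n` be two subchains (pairwise compatible
D-admissible subsets of `[±n]` with weakly increasing cardinalities).  If `|S_i| = |S'_i|` for all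
`i` and the numbers of indices `i` with `|S_i| = n` and `S_i` containing an even number of
negative integers agree, then `τ_{S_1} ⋯ τ_{S_n} = τ_{S'_1} ⋯ τ_{S'_n}` in `R^D_n`. -/
theorem typeD_invariance (n : ℕ) (hn : 2 ≤ n)
    (S S' : ℕ → Finset (PM n))
    (hadm : ∀ i ∈ Finset.Icc 1 n, DAdm n (S i))
    (hcomp : ∀ i ∈ Finset.Icc 1 n, ∀ j ∈ Finset.Icc 1 n, Compat n (S i) (S j))
    (hmono : ∀ i j, 1 ≤ i → i ≤ j → j ≤ n → (S i).card ≤ (S j).card)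
    (hadm' : ∀ i ∈ Finset.Icc 1 n, DAdm n (S' i))
    (hcomp' : ∀ i ∈ Finset.Icc 1 n, ∀ j ∈ Finset.Icc 1 n, Compat n (S' i) (S' j))
    (hmono' : ∀ i j, 1 ≤ i → i ≤ j → j ≤ n → (S' i).card ≤ (S' j).card)
    (hcard : ∀ i ∈ Finset.Icc 1 n, (S i).card = (S' i).card)
    (heven : ((Finset.Icc 1 n).filter (fun i => (S i).card = n ∧ Even (negCount (S i)))).card =
        ((Finset.Icc 1 n).filter (fun i => (S' i).card = n ∧ Even (negCount (S' i)))).card) :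
    (∏ i ∈ Finset.Icc 1 n, tauD n (S i)) = ∏ i ∈ Finset.Icc 1 n, tauD n (S' i) := by
  have key : ∀ U : ℕ → Finset (PM n), (∀ i ∈ Finset.Icc 1 n, DAdm n (U i)) →
      ∃ A : ℕ → IdxD n, ∀ i ∈ Finset.Icc 1 n, (A i).1 = U i := fun U hU =>
    ⟨fun i => if h : DAdm n (U i) then ⟨U i, h⟩ else TypeD.std ⟨0, by omega⟩,
      fun i hi => by simp only [dif_pos (hU i hi)]⟩
  have hprod : ∀ (U : ℕ → Finset (PM n)) (A : ℕ → IdxD n),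
      (∀ i ∈ Finset.Icc 1 n, (A i).1 = U i) →
      ∏ i ∈ Finset.Icc 1 n, tauD n (U i) = ∏ i ∈ Finset.Icc 1 n, TypeD.tau (A i) :=
    fun U A hA => Finset.prod_congr rfl fun i hi => by
      rw [← hA i hi, TypeD.tauD_eq _ (A i).2]
  obtain ⟨A, hA⟩ := key S hadm
  obtain ⟨A', hA'⟩ := key S' hadm'
  rw [hprod S A hA, hprod S' A' hA',
    TypeD.prod_tau_eq_prod_stdOf hn A fun i hi j hj => by
      rw [hA i hi, hA j hj]; exact hcomp i hi j hj,
    TypeD.prod_tau_eq_prod_stdOf hn A' fun i hi j hj => by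
      rw [hA' i hi, hA' j hj]; exact hcomp' i hi j hj]
  refine TypeD.prod_stdOf_eq hn A A' (fun i hi => ?_) ?_
  · rw [hA i hi, hA' i hi, hcard i hi]
  · rw [Finset.filter_congr fun i hi => by rw [hA i hi],
      Finset.filter_congr (s := Finset.Icc 1 n)
        (p := fun i => (A' i).1.card = n ∧ Even (negCount (A' i).1)) fun i hi => by rw [hA' i hi]]
    exact heven
end

section
/- Let S_1,…,S_n be a subchain (pairwise compatible D-admissible subsets of [±n] with weakly increasing cardinalities), let λ be the Young diagram with λ_i = |S_{n+1−i}|, and let s, b_r, c_r be its corner data. If there exists r ∈ {1,…,s} with c_r < 0 or c_r > b_r (equivalently, some step of the zigzag line of lower-right corners of λ fails to cross the anti-diagonal line shifted down half the length of a box), then τ_{S_1}⋯τ_{S_n} = 0 in R^D_n. -/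
open MvPolynomial

/-- `λ_i` extended by `0` for `i > n`. -/
def lamE (n : ℕ) (lam : ℕ → ℕ) (i : ℕ) : ℕ := if i ≤ n then lam i else 0

/-- The sorted list `i_1 < … < i_s` of lower-right corners of `λ`. -/
def cornerL (n : ℕ) (lam : ℕ → ℕ) : List ℕ :=
  ((Finset.Icc 1 n).filter (fun i => lamE n lam (i + 1) < lamE n lam i)).sort (· ≤ ·)

/-- The number `s` of lower-right corners of `λ`. -/
def sC (n : ℕ) (lam : ℕ → ℕ) : ℕ := (cornerL n lam).length

/-- `i_r` (with `i_0 = 0`; out-of-range indices default to `n+1`, where `λ` vanishes). -/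
def iC (n : ℕ) (lam : ℕ → ℕ) (r : ℕ) : ℕ :=
  if r = 0 then 0 else (cornerL n lam).getD (r - 1) (n + 1)

/-- `a_r = i_r − i_{r−1} − 1`. -/
def aC (n : ℕ) (lam : ℕ → ℕ) (r : ℕ) : ℤ := (iC n lam r : ℤ) - iC n lam (r - 1) - 1

/-- `b_r = λ_{i_r} − λ_{i_{r+1}} − 1` (with `λ_{i_{s+1}} = 0`). -/
def bC (n : ℕ) (lam : ℕ → ℕ) (r : ℕ) : ℤ :=
  (lamE n lam (iC n lam r) : ℤ) - lamE n lam (iC n lam (r + 1)) - 1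

/-- `c_r = λ_{i_r} + i_r − n − 1`. -/
def cC (n : ℕ) (lam : ℕ → ℕ) (r : ℕ) : ℤ :=
  (lamE n lam (iC n lam r) : ℤ) + iC n lam r - n - 1

/-- Binomial coefficient `C(x,y)` with `C(x,y) = 0` unless `0 ≤ y ≤ x`. -/
def Cb (x y : ℤ) : ℤ := if 0 ≤ y ∧ y ≤ x then (x.toNat.choose y.toNat : ℤ) else 0

/-- `y_r = C(a_r, c_r) · C(b_r, c_r)`. -/
def yC (n : ℕ) (lam : ℕ → ℕ) (r : ℕ) : ℤ :=
  Cb (aC n lam r) (cC n lam r) * Cb (bC n lam r) (cC n lam r)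

/-- `I(λ) = (−1)^{n+s} y_1 ⋯ y_s`. -/
def IY (n : ℕ) (lam : ℕ → ℕ) : ℤ :=
  (-1) ^ (n + sC n lam) * ∏ r ∈ Finset.Icc 1 (sC n lam), yC n lam r

/-- A moving lemma: if incompatible generators multiply to zero, compatible families of
generators satisfying `P` have fewer than `N` members, and every generator of a compatible family
can be replaced modulo a linear relation by generators outside the family, then `τ t` kills every
product of at least `N` generators satisfying `P`. -/
theorem mul_prod_eq_zero_of_moving {R ι : Type*} [CommRing R] [Fintype ι] [DecidableEq ι]
    (τ : ι → R) (c : ι → ι → Prop) (hc : ∀ i j, ¬ c i j → τ i * τ j = 0)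
    (hrefl : ∀ i, c i i) (t : ι) (P : ι → Prop) (N : ℕ)
    (hN : ∀ F : Finset ι, (∀ i ∈ F, P i) → (∀ i ∈ F, ∀ j ∈ F, c i j) → F.card < N)
    (hrel : ∀ F : Finset ι, (∀ i ∈ F, ∀ j ∈ F, c i j) → t ∈ F → ∀ s ∈ F, P s →
      ∃ a : ι → ℤ, ∑ i, (a i : R) * τ i = 0 ∧ a s = 1 ∧ (∀ u ∈ F, u ≠ s → a u = 0) ∧
        ∀ u, c t u → ¬ P u → a u = 0)
    (M : Multiset ι) (hM : ∀ i ∈ M, P i) (hcard : N ≤ M.card) :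
    τ t * (M.map τ).prod = 0 := by
  induction hk : Fintype.card ι - M.toFinset.card using Nat.strong_induction_on generalizing M with
  | _ k ih =>
  by_cases hcomp : ∀ i ∈ insert t M.toFinset, ∀ j ∈ insert t M.toFinset, c i j
  · by_cases hnd : M.Nodup
    · have h1 := hN M.toFinset (by simpa using hM) (fun i hi j hj =>
        hcomp i (Finset.mem_insert_of_mem hi) j (Finset.mem_insert_of_mem hj))
      rw [Multiset.toFinset_card_of_nodup hnd] at h1
      omega
    · obtain ⟨s, hs⟩ : ∃ s, 1 < M.count s := by
        rw [Multiset.nodup_iff_count_le_one] at hnd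
        push Not at hnd
        exact hnd
      obtain ⟨M₁, rfl⟩ := Multiset.exists_cons_of_mem
        (Multiset.count_pos.1 (by omega : 0 < M.count s))
      rw [Multiset.count_cons_self] at hs
      obtain ⟨M', rfl⟩ := Multiset.exists_cons_of_mem
        (Multiset.count_pos.1 (by omega : 0 < M₁.count s))
      obtain ⟨a, hsum, has, haF, haP⟩ := hrel _ hcomp (Finset.mem_insert_self _ _) s
        (by simp) (hM s (by simp))
      have key : ∀ u, u ≠ s → (a u : R) * τ u * (τ t * (τ s * (M'.map τ).prod)) = 0 := by
        intro u hu
        by_cases huF : u ∈ insert t (s ::ₘ s ::ₘ M').toFinset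
        · simp [haF u huF hu]
        by_cases hctu : c t u
        · by_cases hPu : P u
          · have h2 : (u ::ₘ s ::ₘ M').toFinset = insert u (s ::ₘ s ::ₘ M').toFinset := by
              ext; simp
            have huF' : u ∉ (s ::ₘ s ::ₘ M').toFinset :=
              fun h => huF (Finset.mem_insert_of_mem h)
            have h3 := Finset.card_insert_of_notMem huF'
            have h4 := Finset.card_le_univ (insert u (s ::ₘ s ::ₘ M').toFinset)
            have h5 := ih _ (by rw [h2]; omega) (u ::ₘ s ::ₘ M') (by
              intro i hi
              rcases Multiset.mem_cons.1 hi with rfl | hi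
              · exact hPu
              · exact hM i (Multiset.mem_cons_of_mem hi)) (by simpa using hcard) rfl
            rw [Multiset.map_cons, Multiset.map_cons, Multiset.prod_cons,
              Multiset.prod_cons] at h5
            linear_combination (a u : R) * h5
          · simp [haP u hctu hPu]
        · linear_combination (a u : R) * (τ s * (M'.map τ).prod) * hc t u hctu
      have h6 : (∑ i, (a i : R) * τ i) * (τ t * (τ s * (M'.map τ).prod)) =
          (a s : R) * τ s * (τ t * (τ s * (M'.map τ).prod)) := by
        rw [Finset.sum_mul]
        exact Finset.sum_eq_single s (fun u _ hu => key u hu) (by simp)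
      rw [hsum, has] at h6
      rw [Multiset.map_cons, Multiset.map_cons, Multiset.prod_cons, Multiset.prod_cons]
      linear_combination -h6
  · push Not at hcomp
    obtain ⟨i, hi, j, hj, hij⟩ := hcomp
    have h0 := hc i j hij
    have hsub : ∀ x ∈ insert t M.toFinset, x ∈ t ::ₘ M := by simp
    have hne : j ≠ i := fun h => hij (h ▸ hrefl i)
    obtain ⟨M₁, hM₁⟩ := Multiset.exists_cons_of_mem (hsub i hi)
    have hj' := hsub j hj
    rw [hM₁, Multiset.mem_cons, or_iff_right hne] at hj'
    obtain ⟨M₂, rfl⟩ := Multiset.exists_cons_of_mem hj'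
    rw [← Multiset.prod_cons, ← Multiset.map_cons, hM₁, Multiset.map_cons, Multiset.map_cons,
      Multiset.prod_cons, Multiset.prod_cons]
    linear_combination (M₂.map τ).prod * h0

/-- The signed indicator of `p ∈ [±n]` in `S`: `1` if `p ∈ S`, `−1` if `−p ∈ S`, else `0`. -/
def signedInd {n : ℕ} (p : PM n) (S : Finset (PM n)) : ℤ :=
  if p ∈ S then 1 else if negPM p ∈ S then -1 else 0

/-- The coefficient of `τ_S` in the linear relation attached to the root `p − q`. -/
def rootCoef (n : ℕ) (p q : PM n) (S : Finset (PM n)) : ℤ :=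
  if S.card ≤ n - 2 then signedInd p S - signedInd q S
  else if S.card = n then (signedInd p S - signedInd q S) / 2 else 0

theorem negPM_negPM {n : ℕ} (p : PM n) : negPM (negPM p) = p := by simp [negPM]

theorem eq_or_eq_negPM {n : ℕ} {p q : PM n} (h : p.1 = q.1) : p = q ∨ p = negPM q := by
  obtain ⟨a, b⟩ := p
  obtain ⟨a', b'⟩ := q
  cases b <;> cases b' <;> simp_all [negPM]

section Admissible

variable {n : ℕ} {S T U : Finset (PM n)} {p q : PM n}

theorem DAdm.notMem_of_negPM_mem (hS : DAdm n S) (h : negPM p ∈ S) : p ∉ S :=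
  fun hp => hS.2.1 p hp h

theorem DAdm.eq_of_fst_eq (hS : DAdm n S) (hp : p ∈ S) (hq : q ∈ S) (h : p.1 = q.1) : p = q := by
  rcases eq_or_eq_negPM h with h | h
  · exact h
  · exact absurd (h ▸ hp) (hS.2.1 q hq)

theorem DAdm.card_image_fst (hS : DAdm n S) : (S.image Prod.fst).card = S.card :=
  Finset.card_image_of_injOn fun _ hp _ hq h => hS.eq_of_fst_eq hp hq h

theorem DAdm.card_le (hS : DAdm n S) : S.card ≤ n := by
  rw [← hS.card_image_fst]
  simpa using Finset.card_le_univ (S.image Prod.fst)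

theorem DAdm.card_pos (hS : DAdm n S) : 0 < S.card := hS.1.card_pos

theorem DAdm.card_le_of_ne (hS : DAdm n S) (h : S.card ≠ n) : S.card ≤ n - 2 := by
  have := hS.card_le
  have := hS.2.2
  omega

theorem DAdm.mem_or_negPM_mem (hS : DAdm n S) (h : S.card = n) (p : PM n) :
    p ∈ S ∨ negPM p ∈ S := by
  have h1 : S.image Prod.fst = Finset.univ :=
    Finset.eq_univ_of_card _ (by rw [hS.card_image_fst, h, Fintype.card_fin])
  obtain ⟨q, hq, hqp⟩ := Finset.mem_image.1 (h1 ▸ Finset.mem_univ p.1)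
  rcases eq_or_eq_negPM hqp with rfl | rfl
  · exact .inl hq
  · exact .inr hq

theorem DAdm.exists_notMem (hS : DAdm n S) (h : S.card < n) : ∃ p, p ∉ S ∧ negPM p ∉ S := by
  obtain ⟨k, hk⟩ : ∃ k, k ∉ S.image Prod.fst := by
    by_contra! hall
    have h1 := Finset.eq_univ_of_forall hall
    have h2 := hS.card_image_fst
    rw [h1, Finset.card_univ, Fintype.card_fin] at h2
    omega
  exact ⟨(k, true), fun h => hk (Finset.mem_image_of_mem Prod.fst h),
    fun h => hk (Finset.mem_image_of_mem Prod.fst h)⟩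

theorem Compat.refl (S : Finset (PM n)) : Compat n S S := .inl subset_rfl

theorem Compat.symm (h : Compat n S T) : Compat n T S := by
  rcases h with h | h | ⟨h1, h2, h3⟩
  · exact .inr (.inl h)
  · exact .inl h
  · exact .inr (.inr ⟨h2, h1, by rwa [Finset.inter_comm]⟩)

theorem Compat.subset_of_card_le (h : Compat n S T) (hle : S.card ≤ T.card) (hS : S.card ≠ n) :
    S ⊆ T := by
  rcases h with h | h | h
  · exact h
  · exact (Finset.eq_of_subset_of_card_le h hle).ge
  · exact absurd h.1 hS

theorem Compat.eq_of_card_eq (h : Compat n S T) (hle : S.card = T.card) (hS : S.card ≠ n) :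
    S = T :=
  Finset.eq_of_subset_of_card_le (h.subset_of_card_le hle.le hS) hle.ge

theorem Compat.card_inter (h : Compat n S T) (hS : S.card = n) (hT : T.card = n) (hne : S ≠ T) :
    (S ∩ T).card = n - 1 := by
  rcases h with h | h | h
  · exact absurd (Finset.eq_of_subset_of_card_le h (by omega)) hne
  · exact absurd (Finset.eq_of_subset_of_card_le h (by omega)).symm hne
  · exact h.2.2

theorem Compat.exists_sdiff_eq (hn : 0 < n) (h : Compat n S T) (hS : S.card = n)
    (hT : T.card = n) (hne : S ≠ T) : ∃ p, S \ T = {p} := by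
  rw [← Finset.card_eq_one]
  have h1 := h.card_inter hS hT hne
  have h2 := Finset.card_sdiff_add_card_inter S T
  omega

/-- Among three pairwise compatible sets of full cardinality, two coincide. -/
theorem DAdm.eq_or_eq_of_full (hn : 0 < n) (hS : DAdm n S) (hT : DAdm n T) (hU : DAdm n U)
    (cS : S.card = n) (cT : T.card = n) (cU : U.card = n)
    (hST : Compat n S T) (hSU : Compat n S U) (hTU : Compat n T U) (hne : S ≠ T) :
    U = S ∨ U = T := by
  by_contra! hcon
  obtain ⟨p, hp⟩ := hST.exists_sdiff_eq hn cS cT hne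
  obtain ⟨q, hq⟩ := hSU.exists_sdiff_eq hn cS cU hcon.1.symm
  obtain ⟨r, hr⟩ := hTU.symm.exists_sdiff_eq hn cU cT hcon.2
  have hp' : p ∈ S ∧ p ∉ T := by simpa using (Finset.ext_iff.1 hp p).2 (by simp)
  have hq' : q ∈ S ∧ q ∉ U := by simpa using (Finset.ext_iff.1 hq q).2 (by simp)
  have memT : ∀ x ∈ S, x ≠ p → x ∈ T := fun x hx hxp => by
    by_contra hxT
    exact hxp (by simpa [hx, hxT] using Finset.ext_iff.1 hp x)
  have memU : ∀ x ∈ S, x ≠ q → x ∈ U := fun x hx hxp => by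
    by_contra hxT
    exact hxp (by simpa [hx, hxT] using Finset.ext_iff.1 hq x)
  have memr : ∀ x ∈ U, x ∉ T → x = r := fun x hx hxT => by
    simpa [hx, hxT] using Finset.ext_iff.1 hr x
  have hnqU := (hU.mem_or_negPM_mem cU q).resolve_left hq'.2
  have hnpT := (hT.mem_or_negPM_mem cT p).resolve_left hp'.2
  by_cases hpq : q = p
  · subst hpq
    refine hcon.2 (Finset.eq_of_subset_of_card_le (fun x hx => ?_) (by omega))
    rcases hS.mem_or_negPM_mem cS x with hxS | hxS
    · exact memT x hxS fun h => hq'.2 (h ▸ hx)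
    · by_cases h : negPM x = q
      · rw [← h, negPM_negPM] at hnpT
        exact hnpT
      · exact absurd (memU _ hxS h) (hU.2.1 x hx)
  · have h1 := memr p (memU p hp'.1 (Ne.symm hpq)) hp'.2
    have h2 := memr (negPM q) hnqU (hT.2.1 q (memT q hq'.1 hpq))
    exact hS.2.1 q hq'.1 (h2.trans h1.symm ▸ hp'.1)

theorem signedInd_of_mem (h : p ∈ S) : signedInd p S = 1 := by simp [signedInd, h]

theorem DAdm.signedInd_of_negPM_mem (hS : DAdm n S) (h : negPM p ∈ S) : signedInd p S = -1 := by
  simp [signedInd, h, hS.notMem_of_negPM_mem h]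

theorem signedInd_of_notMem (h : p ∉ S) (h' : negPM p ∉ S) : signedInd p S = 0 := by
  simp [signedInd, h, h']

theorem rootCoef_eq_zero (h : signedInd p S = signedInd q S) : rootCoef n p q S = 0 := by
  simp [rootCoef, h]

theorem rootCoef_of_mem_of_mem (hp : p ∈ S) (hq : q ∈ S) : rootCoef n p q S = 0 :=
  rootCoef_eq_zero (by rw [signedInd_of_mem hp, signedInd_of_mem hq])

theorem rootCoef_of_notMem (hp : p ∉ S) (hp' : negPM p ∉ S) (hq : q ∉ S) (hq' : negPM q ∉ S) :
    rootCoef n p q S = 0 :=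
  rootCoef_eq_zero (by rw [signedInd_of_notMem hp hp', signedInd_of_notMem hq hq'])

theorem signedInd_true (k : Fin n) (S : Finset (PM n)) : signedInd (k, true) S = eps n k S := rfl

theorem DAdm.signedInd_false (hS : DAdm n S) (k : Fin n) :
    signedInd (k, false) S = -eps n k S := by
  have h := hS.2.1 (k, true)
  by_cases h1 : (k, true) ∈ S <;> by_cases h2 : (k, false) ∈ S <;>
    simp_all [signedInd, eps, negPM]

theorem DAdm.eps_of_full (hS : DAdm n S) (h : S.card = n) (k : Fin n) :
    eps n k S = 1 ∨ eps n k S = -1 := by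
  rcases hS.mem_or_negPM_mem h (k, true) with h1 | h1
  · exact .inl (signedInd_of_mem h1)
  · exact .inr (hS.signedInd_of_negPM_mem h1)

end Admissible

/-- The class of the variable indexed by `S` in `R^D_n`. -/
noncomputable def tauIdx (n : ℕ) (S : IdxD n) : RD n := Ideal.Quotient.mk _ (X S)

theorem tauIdx_mul_eq_zero {n : ℕ} (S T : IdxD n) (h : ¬ Compat n S.1 T.1) :
    tauIdx n S * tauIdx n T = 0 := by
  rw [tauIdx, tauIdx, ← map_mul, Ideal.Quotient.eq_zero_iff_mem]
  exact Ideal.subset_span (.inl ⟨S, T, h, rfl⟩)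

theorem sum_mul_tauIdx_eq_zero_of_eps {n : ℕ} (hn : 2 ≤ n) (k l : Fin n) (hkl : k ≠ l) (e : ℤ)
    (he : e = 1 ∨ e = -1) (a : IdxD n → ℤ)
    (ha : ∀ S : IdxD n, a S = if S.1.card ≤ n - 2 then eps n k S.1 - e * eps n l S.1
      else if S.1.card = n then (eps n k S.1 - e * eps n l S.1) / 2 else 0) :
    ∑ S, (a S : RD n) * tauIdx n S = 0 := by
  have h : (∑ S : IdxD n, C (a S) * X S) ∈ Ideal.span (relD n) := by
    refine Ideal.subset_span (.inr ⟨k, l, e, he, hkl, ?_⟩)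
    rw [← Finset.sum_add_distrib]
    refine Finset.sum_congr rfl fun S _ => ?_
    rw [ha S]
    by_cases h1 : S.1.card ≤ n - 2
    · simp [h1, show S.1.card ≠ n by omega]
    · by_cases h2 : S.1.card = n
      · simp [h2, show ¬ n ≤ n - 2 by omega]
      · simp [h1, h2]
  rw [← Ideal.Quotient.eq_zero_iff_mem, map_sum] at h
  rw [← h]
  refine Finset.sum_congr rfl fun S _ => ?_
  rw [map_mul, tauIdx]
  simp

theorem sum_rootCoef_mul_tauIdx {n : ℕ} (hn : 2 ≤ n) (p q : PM n) (hpq : p.1 ≠ q.1) :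
    ∑ S : IdxD n, (rootCoef n p q S.1 : RD n) * tauIdx n S = 0 := by
  obtain ⟨k, a⟩ := p
  obtain ⟨l, b⟩ := q
  simp only at hpq
  cases a <;> cases b
  · refine sum_mul_tauIdx_eq_zero_of_eps hn l k hpq.symm 1 (.inl rfl) _ fun S => ?_
    simp only [rootCoef, S.2.signedInd_false]
    ring_nf
  · have h := sum_mul_tauIdx_eq_zero_of_eps hn k l hpq (-1) (.inr rfl)
      (fun S => -rootCoef n (k, false) (l, true) S.1) fun S => ?_
    · rw [← neg_eq_zero, ← Finset.sum_neg_distrib]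
      refine (Finset.sum_congr rfl fun S _ => ?_).trans h
      push_cast
      ring
    · simp only [rootCoef, S.2.signedInd_false, signedInd_true]
      split_ifs with h1 h2
      · ring
      · rcases S.2.eps_of_full h2 k with h3 | h3 <;> rcases S.2.eps_of_full h2 l with h4 | h4 <;>
          simp [h3, h4]
      · simp
  · refine sum_mul_tauIdx_eq_zero_of_eps hn k l hpq (-1) (.inr rfl) _ fun S => ?_
    simp only [rootCoef, S.2.signedInd_false, signedInd_true]
    ring_nf
  · refine sum_mul_tauIdx_eq_zero_of_eps hn k l hpq 1 (.inl rfl) _ fun S => ?_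
    simp only [rootCoef, signedInd_true]
    ring_nf

/-- In a pairwise compatible family, the members of smaller than full cardinality
have an upper bound of at most `n - 2` elements inside any set containing them all. -/
theorem exists_bound_of_nonfull {n : ℕ} (F : Finset (IdxD n))
    (hF : ∀ U ∈ F, ∀ V ∈ F, Compat n U.1 V.1) :
    ∃ B : Finset (PM n), B.card ≤ n - 2 ∧ (∀ U ∈ F, U.1.card ≠ n → U.1 ⊆ B) ∧
      ∀ A : Finset (PM n), (∀ U ∈ F, U.1.card ≠ n → U.1 ⊆ A) → B ⊆ A := by
  by_cases hne : (F.filter fun U => U.1.card ≠ n).Nonempty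
  · obtain ⟨B, hB, hmax⟩ := Finset.exists_max_image _ (fun U : IdxD n => U.1.card) hne
    rw [Finset.mem_filter] at hB
    exact ⟨B.1, B.2.card_le_of_ne hB.2, fun U hU hUn =>
      (hF U hU B hB.1).subset_of_card_le (hmax U (Finset.mem_filter.2 ⟨hU, hUn⟩)) hUn,
      fun A hA => hA B hB.1 hB.2⟩
  · refine ⟨∅, by simp, fun U hU hUn => absurd ⟨U, Finset.mem_filter.2 ⟨hU, hUn⟩⟩ hne,
      fun A _ => Finset.empty_subset A⟩

theorem exists_mem_of_below {n : ℕ} (F : Finset (IdxD n))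
    (hF : ∀ U ∈ F, ∀ V ∈ F, Compat n U.1 V.1) (S : IdxD n) :
    ∃ p ∈ S.1, ∀ U ∈ F, U.1 ⊂ S.1 → p ∉ U.1 := by
  by_cases hne : (F.filter fun U => U.1 ⊂ S.1).Nonempty
  · obtain ⟨B, hB, hmax⟩ := Finset.exists_max_image _ (fun U : IdxD n => U.1.card) hne
    rw [Finset.mem_filter] at hB
    obtain ⟨p, hpS, hpB⟩ := Finset.exists_of_ssubset hB.2
    refine ⟨p, hpS, fun U hU hUS hpU => hpB ?_⟩
    have h1 := Finset.card_lt_card hUS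
    have h2 := S.2.card_le
    exact (hF U hU B hB.1).subset_of_card_le (hmax U (Finset.mem_filter.2 ⟨hU, hUS⟩))
      (by omega) hpU
  · obtain ⟨p, hp⟩ := S.2.1
    exact ⟨p, hp, fun U hU hUS => absurd ⟨U, Finset.mem_filter.2 ⟨hU, hUS⟩⟩ hne⟩

theorem exists_notMem_of_above {n : ℕ} (hn : 2 ≤ n) (F : Finset (IdxD n))
    (hF : ∀ U ∈ F, ∀ V ∈ F, Compat n U.1 V.1) (S : IdxD n) (hS : S.1.card ≠ n) :
    ∃ q, q ∉ S.1 ∧ negPM q ∉ S.1 ∧ ∀ U ∈ F, S.1 ⊂ U.1 → q ∈ U.1 := by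
  have hSle := S.2.card_le_of_ne hS
  by_cases hne : (F.filter fun U => S.1 ⊂ U.1).Nonempty
  · suffices h : ∃ q, q ∉ S.1 ∧ ∀ U ∈ F, S.1 ⊂ U.1 → q ∈ U.1 by
      obtain ⟨q, hq, hqU⟩ := h
      obtain ⟨U, hU⟩ := hne
      rw [Finset.mem_filter] at hU
      exact ⟨q, hq, fun h => U.2.notMem_of_negPM_mem (hU.2.subset h) (hqU U hU.1 hU.2), hqU⟩
    obtain ⟨A, hA, hmin⟩ := Finset.exists_min_image _ (fun U : IdxD n => U.1.card) hne
    rw [Finset.mem_filter] at hA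
    by_cases hAn : A.1.card = n
    · have hfull : ∀ U ∈ F, S.1 ⊂ U.1 → U.1.card = n := fun U hU hSU => by
        have h1 := hmin U (Finset.mem_filter.2 ⟨hU, hSU⟩)
        have h2 := U.2.card_le
        omega
      by_cases hQ : ∃ Q ∈ F, S.1 ⊂ Q.1 ∧ A.1 ≠ Q.1
      · obtain ⟨Q, hQF, hSQ, hAQ⟩ := hQ
        have h1 := (hF A hA.1 Q hQF).card_inter hAn (hfull Q hQF hSQ) hAQ
        obtain ⟨q, hq, hqS⟩ := Finset.exists_mem_notMem_of_card_lt_card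
          (show S.1.card < (A.1 ∩ Q.1).card by omega)
        rw [Finset.mem_inter] at hq
        refine ⟨q, hqS, fun U hU hSU => ?_⟩
        rcases A.2.eq_or_eq_of_full (by omega) Q.2 U.2 hAn (hfull Q hQF hSQ) (hfull U hU hSU)
          (hF A hA.1 Q hQF) (hF A hA.1 U hU) (hF Q hQF U hU) hAQ with h | h
        · exact h ▸ hq.1
        · exact h ▸ hq.2
      · push Not at hQ
        obtain ⟨q, hqA, hqS⟩ := Finset.exists_of_ssubset hA.2
        exact ⟨q, hqS, fun U hU hSU => hQ U hU hSU ▸ hqA⟩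
    · obtain ⟨q, hqA, hqS⟩ := Finset.exists_of_ssubset hA.2
      exact ⟨q, hqS, fun U hU hSU => (hF A hA.1 U hU).subset_of_card_le
        (hmin U (Finset.mem_filter.2 ⟨hU, hSU⟩)) hAn hqA⟩
  · obtain ⟨q, hq, hq'⟩ := S.2.exists_notMem (by omega)
    exact ⟨q, hq, hq', fun U hU hUS => absurd ⟨U, Finset.mem_filter.2 ⟨hU, hUS⟩⟩ hne⟩

/-- For a member `S` of a pairwise compatible family `F` there is a root pairing to `1` with `S`,
and to `0` with every set lying on the other side of a member `T` of `F` comparable to `S`,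
as well as with every other full member of `F`. -/
theorem exists_root {n : ℕ} (hn : 2 ≤ n) (F : Finset (IdxD n))
    (hF : ∀ U ∈ F, ∀ V ∈ F, Compat n U.1 V.1) (S : IdxD n) (hS : S ∈ F) :
    ∃ p q : PM n, p.1 ≠ q.1 ∧ rootCoef n p q S.1 = 1 ∧
      (∀ T ∈ F, ∀ U : IdxD n, S.1 ⊂ T.1 → T.1 ⊆ U.1 → rootCoef n p q U.1 = 0) ∧
      (∀ T ∈ F, ∀ U : IdxD n, T.1 ⊂ S.1 → U.1 ⊆ T.1 → rootCoef n p q U.1 = 0) ∧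
      (∀ Q ∈ F, S.1.card = n → Q.1.card = n → Q ≠ S → rootCoef n p q Q.1 = 0) := by
  by_cases hSn : S.1.card = n
  · obtain ⟨B, hBn, hFB, hB⟩ := exists_bound_of_nonfull F hF
    have hBV : ∀ V ∈ F, V.1.card = n → B ⊆ V.1 := fun V hV hVn => hB _ fun U hU hUn =>
      (hF U hU V hV).subset_of_card_le (U.2.card_le.trans hVn.ge) hUn
    obtain ⟨p, r, hpr, hp, hr, hpB, hrB, hQ⟩ : ∃ p r, p ≠ r ∧ p ∈ S.1 ∧ r ∈ S.1 ∧ p ∉ B ∧ r ∉ B ∧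
        ∀ Q ∈ F, Q.1.card = n → Q ≠ S → p ∉ Q.1 ∧ r ∈ Q.1 := by
      by_cases hQ : ∃ Q ∈ F, Q.1.card = n ∧ S.1 ≠ Q.1
      · obtain ⟨Q, hQF, hQn, hSQ⟩ := hQ
        have h1 := (hF S hS Q hQF).card_inter hSn hQn hSQ
        obtain ⟨r, hr, hrB⟩ := Finset.exists_mem_notMem_of_card_lt_card
          (show B.card < (S.1 ∩ Q.1).card by omega)
        rw [Finset.mem_inter] at hr
        obtain ⟨p, hp⟩ := (hF S hS Q hQF).exists_sdiff_eq (by omega) hSn hQn hSQ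
        have hp' : p ∈ S.1 ∧ p ∉ Q.1 := by simpa using (Finset.ext_iff.1 hp p).2 (by simp)
        refine ⟨p, r, fun h => hp'.2 (h ▸ hr.2), hp'.1, hr.1,
          fun h => hp'.2 (hBV Q hQF hQn h), hrB, fun V hV hVn hVS => ?_⟩
        rcases S.2.eq_or_eq_of_full (by omega) Q.2 V.2 hSn hQn hVn
          (hF S hS Q hQF) (hF S hS V hV) (hF Q hQF V hV) hSQ with h | h
        · exact absurd (Subtype.ext h) hVS
        · rw [h]
          exact ⟨hp'.2, hr.2⟩
      · push Not at hQ
        have h1 := Finset.card_sdiff_add_card_eq_card (hBV S hS hSn)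
        obtain ⟨p, hp, r, hr, hpr⟩ := Finset.one_lt_card.1 (show 1 < (S.1 \ B).card by omega)
        rw [Finset.mem_sdiff] at hp hr
        exact ⟨p, r, hpr, hp.1, hr.1, hp.2, hr.2, fun Q hQF hQn hQS =>
          absurd (Subtype.ext (hQ Q hQF hQn).symm) hQS⟩
    have hr' : negPM (negPM r) ∈ S.1 := (negPM_negPM r).symm ▸ hr
    refine ⟨p, negPM r, fun h => hpr (S.2.eq_of_fst_eq hp hr h), ?_, ?_, ?_, ?_⟩
    · simp [rootCoef, signedInd_of_mem hp, S.2.signedInd_of_negPM_mem hr', hSn,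
        show ¬ n ≤ n - 2 by omega]
    · intro T _ U hST _
      have h1 := Finset.card_lt_card hST
      have h2 := T.2.card_le
      omega
    · intro T hT U hTS hUT
      have h1 := Finset.card_lt_card hTS
      have hUB := hUT.trans (hFB T hT (by omega))
      have hUS := hUT.trans hTS.subset
      exact rootCoef_of_notMem (fun h => hpB (hUB h)) (fun h => S.2.2.1 p hp (hUS h))
        (fun h => S.2.2.1 r hr (hUS h)) (fun h => hrB (hUB (negPM_negPM r ▸ h)))
    · intro Q hQF _ hQn hQS
      obtain ⟨h1, h2⟩ := hQ Q hQF hQn hQS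
      refine rootCoef_eq_zero ?_
      rw [Q.2.signedInd_of_negPM_mem ((Q.2.mem_or_negPM_mem hQn p).resolve_left h1),
        Q.2.signedInd_of_negPM_mem ((negPM_negPM r).symm ▸ h2)]
  · obtain ⟨p, hpS, hp⟩ := exists_mem_of_below F hF S
    obtain ⟨q, hqS, hqS', hq⟩ := exists_notMem_of_above hn F hF S hSn
    refine ⟨p, q, fun h => ?_, ?_, ?_, ?_, fun _ _ h => absurd h hSn⟩
    · rcases eq_or_eq_negPM h with rfl | rfl
      · exact hqS hpS
      · exact hqS' hpS
    · simp [rootCoef, S.2.card_le_of_ne hSn, signedInd_of_mem hpS, signedInd_of_notMem hqS hqS']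
    · intro T hT U hST hTU
      exact rootCoef_of_mem_of_mem (hTU (hST.subset hpS)) (hTU (hq T hT hST))
    · intro T hT U hTS hUT
      have hUS := hUT.trans hTS.subset
      exact rootCoef_of_notMem (fun h => hp T hT hTS (hUT h)) (fun h => S.2.2.1 p hpS (hUS h))
        (fun h => hqS (hUS h)) (fun h => hqS' (hUS h))

theorem exists_relation {n : ℕ} (hn : 2 ≤ n) (F : Finset (IdxD n))
    (hF : ∀ U ∈ F, ∀ V ∈ F, Compat n U.1 V.1) (S : IdxD n) (hS : S ∈ F) :
    ∃ a : IdxD n → ℤ, ∑ U, (a U : RD n) * tauIdx n U = 0 ∧ a S = 1 ∧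
      (∀ U ∈ F, U ≠ S → a U = 0) ∧
      (∀ T ∈ F, ∀ U : IdxD n, S.1 ⊂ T.1 → T.1 ⊆ U.1 → a U = 0) ∧
      (∀ T ∈ F, ∀ U : IdxD n, T.1 ⊂ S.1 → U.1 ⊆ T.1 → a U = 0) := by
  obtain ⟨p, q, hpq, h1, h2, h3, h4⟩ := exists_root hn F hF S hS
  refine ⟨fun U => rootCoef n p q U.1, sum_rootCoef_mul_tauIdx hn p q hpq, h1,
    fun U hU hUS => ?_, h2, h3⟩
  have hne : U.1 ≠ S.1 := fun h => hUS (Subtype.ext h)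
  rcases hF U hU S hS with h | h | h
  · exact h3 U hU U (h.ssubset_of_ne hne) subset_rfl
  · exact h2 U hU U (h.ssubset_of_ne hne.symm) subset_rfl
  · exact h4 U hU h.2.1 h.1 hUS

theorem card_lt_of_forall_ssubset {n : ℕ} (T : IdxD n) (F : Finset (IdxD n))
    (hFT : ∀ U ∈ F, U.1 ⊂ T.1) (hF : ∀ U ∈ F, ∀ V ∈ F, Compat n U.1 V.1) :
    F.card < T.1.card := by
  have hT := T.2.card_pos
  have h : F.card ≤ (Finset.Icc 1 (T.1.card - 1)).card := by
    refine Finset.card_le_card_of_injOn (fun U => U.1.card) (fun U hU => ?_) fun U hU V hV h => ?_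
    · have h1 := U.2.card_pos
      have h2 := Finset.card_lt_card (hFT U hU)
      simp only [Finset.coe_Icc, Set.mem_Icc]
      omega
    · have h1 := T.2.card_le
      have h2 := Finset.card_lt_card (hFT U hU)
      exact Subtype.ext ((hF U hU V hV).eq_of_card_eq h (by omega))
  rw [Nat.card_Icc] at h
  omega

theorem card_add_card_le_of_forall_ssubset {n : ℕ} (hn : 2 ≤ n) (T : IdxD n) (hT : T.1.card ≠ n)
    (F : Finset (IdxD n))
    (hFT : ∀ U ∈ F, T.1 ⊂ U.1) (hF : ∀ U ∈ F, ∀ V ∈ F, Compat n U.1 V.1) :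
    F.card + T.1.card ≤ n := by
  have hTn := T.2.card_le_of_ne hT
  have h1 : (F.filter fun U => U.1.card = n).card ≤ 2 := by
    by_contra! h
    obtain ⟨U, hU, V, hV, W, hW, hUV, hUW, hVW⟩ := Finset.two_lt_card.1 h
    rw [Finset.mem_filter] at hU hV hW
    rcases U.2.eq_or_eq_of_full (by omega) V.2 W.2 hU.2 hV.2 hW.2 (hF U hU.1 V hV.1)
      (hF U hU.1 W hW.1) (hF V hV.1 W hW.1) (fun h => hUV (Subtype.ext h)) with h | h
    · exact hUW (Subtype.ext h.symm)
    · exact hVW (Subtype.ext h.symm)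
  have h2 : (F.filter fun U => ¬ U.1.card = n).card ≤
      (Finset.Icc (T.1.card + 1) (n - 2)).card := by
    refine Finset.card_le_card_of_injOn (fun U => U.1.card) (fun U hU => ?_) fun U hU V hV h => ?_
    · rw [Finset.mem_coe, Finset.mem_filter] at hU
      have h3 := U.2.card_le_of_ne hU.2
      have h4 := Finset.card_lt_card (hFT U hU.1)
      simp only [Finset.coe_Icc, Set.mem_Icc]
      omega
    · rw [Finset.mem_coe, Finset.mem_filter] at hU hV
      exact Subtype.ext ((hF U hU.1 V hV.1).eq_of_card_eq h hU.2)
  have h3 := Finset.card_filter_add_card_filter_not (s := F) (fun U => U.1.card = n)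
  rw [Nat.card_Icc] at h2
  omega

theorem tauIdx_mul_prod_eq_zero_of_below {n : ℕ} (hn : 2 ≤ n) (T : IdxD n) (hT : T.1.card ≠ n)
    (M : Multiset (IdxD n)) (hM : ∀ U ∈ M, U.1 ⊂ T.1) (hcard : T.1.card ≤ M.card) :
    tauIdx n T * (M.map (tauIdx n)).prod = 0 := by
  refine mul_prod_eq_zero_of_moving (tauIdx n) (fun U V => Compat n U.1 V.1)
    tauIdx_mul_eq_zero (fun U => Compat.refl U.1) T (fun U => U.1 ⊂ T.1) T.1.card
    (card_lt_of_forall_ssubset T) (fun F hF hTF S hS hST => ?_) M hM hcard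
  obtain ⟨a, h1, h2, h3, h4, -⟩ := exists_relation hn F hF S hS
  refine ⟨a, h1, h2, h3, fun U hTU hU => h4 T hTF U hST ?_⟩
  rcases hTU with h | h | h
  · exact h
  · by_contra hcon
    exact hU ⟨h, hcon⟩
  · exact absurd h.1 hT

theorem tauIdx_mul_prod_eq_zero_of_above {n : ℕ} (hn : 2 ≤ n) (T : IdxD n) (hT : T.1.card ≠ n)
    (M : Multiset (IdxD n)) (hM : ∀ U ∈ M, T.1 ⊂ U.1) (hcard : n < M.card + T.1.card) :
    tauIdx n T * (M.map (tauIdx n)).prod = 0 := by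
  have hTn := T.2.card_le
  refine mul_prod_eq_zero_of_moving (tauIdx n) (fun U V => Compat n U.1 V.1)
    tauIdx_mul_eq_zero (fun U => Compat.refl U.1) T (fun U => T.1 ⊂ U.1) (n - T.1.card + 1)
    (fun F hFT hF => ?_) (fun F hF hTF S hS hST => ?_) M hM (by omega)
  · have := card_add_card_le_of_forall_ssubset hn T hT F hFT hF
    omega
  · obtain ⟨a, h1, h2, h3, -, h5⟩ := exists_relation hn F hF S hS
    refine ⟨a, h1, h2, h3, fun U hTU hU => h5 T hTF U hST ?_⟩
    rcases hTU with h | h | h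
    · by_contra hcon
      exact hU ⟨h, hcon⟩
    · exact h
    · exact absurd h.1 hT

/-- A product over an index set `t` vanishes if the subproduct over some `insert j s ⊆ t` does. -/
theorem prod_eq_zero_of_mul_prod_eq_zero {R ι : Type*} [CommRing R] [DecidableEq ι]
    {s t : Finset ι} {j : ι} (hj : j ∈ t) (hjs : j ∉ s) (hst : s ⊆ t) (f : ι → R)
    (h : f j * ∏ i ∈ s, f i = 0) : ∏ i ∈ t, f i = 0 := by
  rw [← Finset.prod_insert hjs] at h
  rw [← Finset.prod_sdiff (Finset.insert_subset hj hst), h, mul_zero]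

theorem iC_mem {n : ℕ} {lam : ℕ → ℕ} {r : ℕ} (h1 : 1 ≤ r) (hr : r ≤ sC n lam) :
    (1 ≤ iC n lam r ∧ iC n lam r ≤ n) ∧ lamE n lam (iC n lam r + 1) < lamE n lam (iC n lam r) := by
  have hlt : r - 1 < (cornerL n lam).length := by unfold sC at hr; omega
  have h : iC n lam r ∈ cornerL n lam := by
    rw [iC, if_neg (by omega), List.getD_eq_getElem _ _ hlt]
    exact List.getElem_mem hlt
  rw [cornerL, Finset.mem_sort, Finset.mem_filter, Finset.mem_Icc] at h
  exact h

theorem iC_lt_iC_succ {n : ℕ} {lam : ℕ → ℕ} {r : ℕ} (h1 : 1 ≤ r) (hr : r < sC n lam) :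
    iC n lam r < iC n lam (r + 1) := by
  unfold sC at hr
  rw [iC, iC, if_neg (by omega), if_neg (by omega), List.getD_eq_getElem _ _ (by omega),
    List.getD_eq_getElem _ _ (by omega)]
  have hs : (cornerL n lam).SortedLT := Finset.sortedLT_sort _
  exact hs.getElem_lt_getElem_of_lt (by omega)

theorem iC_of_lt {n : ℕ} {lam : ℕ → ℕ} {r : ℕ} (hr : sC n lam < r) : iC n lam r = n + 1 := by
  unfold sC at hr
  rw [iC, if_neg (by omega), List.getD_eq_default _ _ (by omega)]

/-- vanishing property, type `D_n`. For a subchain `S_1,…,S_n` of pairwise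
compatible D-admissible subsets of `[±n]` with weakly increasing cardinalities and
`λ_i = |S_{n+1−i}|`: if some `r ∈ {1,…,s}` has `c_r < 0` or `c_r > b_r`, then
`τ_{S_1} ⋯ τ_{S_n} = 0` in `R^D_n`. -/
theorem typeD_vanishing (n : ℕ) (hn : 2 ≤ n)
    (S : ℕ → Finset (PM n))
    (hadm : ∀ i ∈ Finset.Icc 1 n, DAdm n (S i))
    (hcomp : ∀ i ∈ Finset.Icc 1 n, ∀ j ∈ Finset.Icc 1 n, Compat n (S i) (S j))
    (hmono : ∀ i j, 1 ≤ i → i ≤ j → j ≤ n → (S i).card ≤ (S j).card)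
    (hbad : ∃ r ∈ Finset.Icc 1 (sC n (fun i => (S (n + 1 - i)).card)),
        cC n (fun i => (S (n + 1 - i)).card) r < 0 ∨
        bC n (fun i => (S (n + 1 - i)).card) r < cC n (fun i => (S (n + 1 - i)).card) r) :
    (∏ i ∈ Finset.Icc 1 n, tauD n (S i)) = 0 := by
  set lam : ℕ → ℕ := fun i => (S (n + 1 - i)).card with hlam
  obtain ⟨f, hf⟩ : ∃ f : ℕ → IdxD n, ∀ i ∈ Finset.Icc 1 n, (f i).1 = S i :=
    ⟨fun i => if h : DAdm n (S i) then ⟨S i, h⟩ else ⟨S 1, hadm 1 (by simp; omega)⟩,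
      fun i hi => by simp [hadm i hi]⟩
  have hprod : ∏ i ∈ Finset.Icc 1 n, tauD n (S i) = ∏ i ∈ Finset.Icc 1 n, tauIdx n (f i) :=
    Finset.prod_congr rfl fun i hi => by
      rw [tauD, dif_pos (hadm i hi), tauIdx]
      exact congrArg _ (congrArg _ (Subtype.ext (hf i hi).symm))
  rw [hprod]
  have hcompf : ∀ i ∈ Finset.Icc 1 n, ∀ j ∈ Finset.Icc 1 n, Compat n (f i).1 (f j).1 := by
    intro i hi j hj
    rw [hf i hi, hf j hj]
    exact hcomp i hi j hj
  have hlamf : ∀ i, 1 ≤ i → i ≤ n → lamE n lam i = (f (n + 1 - i)).1.card := by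
    intro i h1 h2
    rw [lamE, if_pos h2, hf _ (Finset.mem_Icc.2 (by omega))]
  have hmonof : ∀ i j, 1 ≤ i → i ≤ j → j ≤ n → (f i).1.card ≤ (f j).1.card := by
    intro i j h1 h2 h3
    rw [hf i (Finset.mem_Icc.2 (by omega)), hf j (Finset.mem_Icc.2 (by omega))]
    exact hmono i j h1 h2 h3
  have hssub : ∀ i ∈ Finset.Icc 1 n, ∀ j ∈ Finset.Icc 1 n, (f i).1.card < (f j).1.card →
      (f i).1 ⊂ (f j).1 := by
    intro i hi j hj hlt
    have h1 := (f j).2.card_le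
    refine ((hcompf i hi j hj).subset_of_card_le hlt.le (by omega)).ssubset_of_ne ?_
    exact fun h => hlt.ne (congrArg _ h)
  obtain ⟨r, hr, hbad⟩ := hbad
  rw [Finset.mem_Icc] at hr
  obtain ⟨⟨hi1, hin⟩, hcorner⟩ := iC_mem hr.1 hr.2
  rcases hbad with hneg | hbig
  · rw [cC] at hneg
    generalize iC n lam r = i at *
    rw [hlamf i hi1 hin] at hneg hcorner
    have hTpos := (f (n + 1 - i)).2.card_pos
    rw [hlamf (i + 1) (by omega) (by omega)] at hcorner
    refine prod_eq_zero_of_mul_prod_eq_zero (s := Finset.Icc 1 (n - i)) (j := n + 1 - i)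
      (Finset.mem_Icc.2 (by omega)) (by simp; omega) (Finset.Icc_subset_Icc_right (by omega)) _ ?_
    have h := tauIdx_mul_prod_eq_zero_of_below hn (f (n + 1 - i)) (by omega)
      ((Finset.Icc 1 (n - i)).val.map f) (fun U hU => ?_) (by simp; omega)
    · rwa [Multiset.map_map] at h
    · obtain ⟨j, hj, rfl⟩ := Multiset.mem_map.1 hU
      rw [Finset.mem_val, Finset.mem_Icc] at hj
      have h1 := hmonof j (n + 1 - (i + 1)) hj.1 (by omega) (by omega)
      exact hssub _ (Finset.mem_Icc.2 (by omega)) _ (Finset.mem_Icc.2 (by omega)) (by omega)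
  · rw [bC, cC] at hbig
    rcases hr.2.eq_or_lt with hrs | hrs
    · have h0 : lamE n lam (iC n lam (r + 1)) = 0 := by
        rw [iC_of_lt (by omega), lamE, if_neg (by omega)]
      omega
    · have hii := iC_lt_iC_succ hr.1 hrs
      obtain ⟨⟨-, hin'⟩, -⟩ := iC_mem (n := n) (lam := lam) (r := r + 1) (by omega) hrs
      generalize iC n lam (r + 1) = i' at *
      generalize iC n lam r = i at *
      rw [hlamf i hi1 hin, hlamf i' (by omega) hin'] at hbig
      rw [hlamf i hi1 hin, hlamf (i + 1) (by omega) (by omega)] at hcorner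
      have hle := hmonof (n + 1 - i') (n + 1 - (i + 1)) (by omega) (by omega) (by omega)
      have hn' := (f (n + 1 - i)).2.card_le
      refine prod_eq_zero_of_mul_prod_eq_zero (s := Finset.Icc (n + 1 - i) n) (j := n + 1 - i')
        (Finset.mem_Icc.2 (by omega)) (by simp; omega) (Finset.Icc_subset_Icc_left (by omega)) _ ?_
      have h := tauIdx_mul_prod_eq_zero_of_above hn (f (n + 1 - i')) (by omega)
        ((Finset.Icc (n + 1 - i) n).val.map f) (fun U hU => ?_) (by simp; omega)
      · rwa [Multiset.map_map] at h
      · obtain ⟨j, hj, rfl⟩ := Multiset.mem_map.1 hU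
        rw [Finset.mem_val, Finset.mem_Icc] at hj
        have h1 := hmonof (n + 1 - i) j (by omega) hj.1 hj.2
        exact hssub _ (Finset.mem_Icc.2 (by omega)) _ (Finset.mem_Icc.2 (by omega)) (by omega)
end

section
/- In R_{G2} one has the identities τ_{{3,−2}}² = − τ_{{3,−2}}·τ_{{3}} and τ_{{3}}² = − 3·τ_{{3,−2}}·τ_{{3}}. (Since τ_{{3,−2}}·τ_{{3}} is the class of a point, these express the G_2 intersection numbers ⟨τ_{{3,−2}}τ_{{3}}, μ_X⟩ = 1, ⟨τ_{{3,−2}}², μ_X⟩ = −1, and ⟨τ_{{3}}², μ_X⟩ = −3.) -/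
open MvPolynomial

/-- The family `𝒮` of subsets of `{±1, ±2, ±3}` indexing the invariant divisors for `G_2`. -/
def SG2 : Finset (Finset ℤ) :=
  {({3, -2} : Finset ℤ), {-3, 2}, {3, -1}, {-3, 1}, {2, -1}, {-2, 1},
    {3}, {-3}, {2}, {-2}, {1}, {-1}}

/-- Index type of the variables of `R_{G2}`. -/
abbrev IdxG := {S : Finset ℤ // S ∈ SG2}

/-- The variable `τ_S` as a polynomial (zero for `S ∉ 𝒮`). -/
noncomputable def XG (S : Finset ℤ) : MvPolynomial IdxG ℤ :=
  if h : S ∈ SG2 then X (⟨S, h⟩ : IdxG) else 0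

/-- The linear relation coming from the simple root `α_1 = t_1 − t_2`. -/
noncomputable def relG1 : MvPolynomial IdxG ℤ :=
  XG {3, -2} + XG {-3, 1} + 2 * XG {-2, 1} + XG {-2} + XG {1}
    - XG {-3, 2} - XG {3, -1} - 2 * XG {2, -1} - XG {2} - XG {-1}

/-- The linear relation coming from the simple root `α_2 = −2t_1 + t_2 + t_3`. -/
noncomputable def relG2 : MvPolynomial IdxG ℤ :=
  3 * XG {3, -1} + 3 * XG {2, -1} + XG {3} + XG {2} + 2 * XG {-1}
    - 3 * XG {-3, 1} - 3 * XG {-2, 1} - XG {-3} - XG {-2} - 2 * XG {1}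

/-- Generators of the defining ideal of `R_{G2}`: (i) products `τ_S τ_T` for incomparable
`S, T ∈ 𝒮`; (ii) the two linear relations. -/
noncomputable def relG : Set (MvPolynomial IdxG ℤ) :=
  {p | ∃ S T : IdxG, ¬ S.1 ⊆ T.1 ∧ ¬ T.1 ⊆ S.1 ∧ p = X S * X T} ∪ {relG1, relG2}

/-- The ring `R_{G2}`. -/
abbrev RG := MvPolynomial IdxG ℤ ⧸ Ideal.span relG

/-- The class `τ_S ∈ R_{G2}`. -/
noncomputable def tauG (S : Finset ℤ) : RG := Ideal.Quotient.mk _ (XG S)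

theorem tauG_mul_eq_zero {S T : Finset ℤ} (hS : S ∈ SG2) (hT : T ∈ SG2)
    (h : ¬ S ⊆ T ∧ ¬ T ⊆ S) : tauG S * tauG T = 0 := by
  rw [tauG, tauG, ← map_mul, Ideal.Quotient.eq_zero_iff_mem]
  refine Ideal.subset_span (Or.inl ⟨⟨S, hS⟩, ⟨T, hT⟩, h.1, h.2, ?_⟩)
  rw [XG, XG, dif_pos hS, dif_pos hT]

theorem tauG_relG1 :
    tauG {3, -2} + tauG {-3, 1} + 2 * tauG {-2, 1} + tauG {-2} + tauG {1}
      - tauG {-3, 2} - tauG {3, -1} - 2 * tauG {2, -1} - tauG {2} - tauG {-1} = 0 := by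
  have h : Ideal.Quotient.mk (Ideal.span relG) relG1 = 0 :=
    Ideal.Quotient.eq_zero_iff_mem.2 (Ideal.subset_span (Or.inr (Or.inl rfl)))
  simpa only [tauG, relG1, map_add, map_sub, map_mul, map_ofNat] using h

theorem tauG_relG2 :
    3 * tauG {3, -1} + 3 * tauG {2, -1} + tauG {3} + tauG {2} + 2 * tauG {-1}
      - 3 * tauG {-3, 1} - 3 * tauG {-2, 1} - tauG {-3} - tauG {-2} - 2 * tauG {1} = 0 := by
  have h : Ideal.Quotient.mk (Ideal.span relG) relG2 = 0 :=
    Ideal.Quotient.eq_zero_iff_mem.2 (Ideal.subset_span (Or.inr (Or.inr rfl)))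
  simpa only [tauG, relG2, map_add, map_sub, map_mul, map_ofNat] using h

/-- In `R_{G2}` one has `τ_{3,−2}² = −τ_{3,−2} τ_{3}` and
`τ_{3}² = −3 τ_{3,−2} τ_{3}`; since `τ_{3,−2} τ_{3}` is the class of a point, these express
the `G_2` intersection numbers `⟨τ_{3,−2} τ_{3}, μ⟩ = 1`, `⟨τ_{3,−2}², μ⟩ = −1`,
`⟨τ_{3}², μ⟩ = −3`. -/
theorem G2_intersection_numbers :
    tauG {3, -2} ^ 2 = - (tauG {3, -2} * tauG {3}) ∧
    tauG {3} ^ 2 = - (3 * (tauG {3, -2} * tauG {3})) := by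
  constructor
  · have h (T : Finset ℤ) (hT : T ∈ SG2 := by decide)
        (hST : ¬ {3, -2} ⊆ T ∧ ¬ T ⊆ {3, -2} := by decide) :=
      tauG_mul_eq_zero (S := {3, -2}) (by decide) hT hST
    linear_combination tauG {3, -2} * (tauG_relG1 + tauG_relG2)
      + h {-3, 2} - 2 * h {3, -1} + 2 * h {-3, 1} - h {2, -1} + h {-2, 1} + h {-3}
      + h {1} - h {-1}
  · have h (T : Finset ℤ) (hT : T ∈ SG2 := by decide)
        (hST : ¬ {3} ⊆ T ∧ ¬ T ⊆ {3} := by decide) :=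
      tauG_mul_eq_zero (S := {3}) (by decide) hT hST
    linear_combination tauG {3} * (3 * tauG_relG1 + tauG_relG2)
      + 3 * h {-3, 2} + 3 * h {2, -1} - 3 * h {-2, 1} + h {-3} + 2 * h {2} - 2 * h {-2}
      - h {1} + h {-1}
end
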